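/- arXiv:2201.11100 — 5 statements merged into one kernel-verified Lean document; each statement's English description precedes it below -/
import Mathlib

section
/- Let p, x₀ ∈ ℝ², R > 0 with x₀ ∈ B(p,R), and let ν ∈ ℝ. Then λ₁(B(p,R), A_{x₀,ν}) ≤ λ₁(B(x₀,R), A_{x₀,ν}); that is, among all disks of the same radius, the first magnetic Neumann eigenvalue of the Aharonov–Bohm operator with pole x₀ is maximized by the disk centered at the pole x₀. -/
open MeasureTheory

noncomputable def AB (x₀ : EuclideanSpace ℝ (Fin 2)) (ν : ℝ)
    (x : EuclideanSpace ℝ (Fin 2)) : Fin 2 → ℝ := fun i =>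
  if i = 0 then -ν * (x 1 - x₀ 1) / ‖x - x₀‖ ^ 2 else ν * (x 0 - x₀ 0) / ‖x - x₀‖ ^ 2

noncomputable def magGradSq (A : EuclideanSpace ℝ (Fin 2) → Fin 2 → ℝ)
    (u : EuclideanSpace ℝ (Fin 2) → ℂ) (x : EuclideanSpace ℝ (Fin 2)) : ℝ :=
  ∑ i : Fin 2, ‖fderiv ℝ u x (EuclideanSpace.single i 1) - Complex.I * u x * (A x i)‖ ^ 2

def VanishesNear (x₀ : EuclideanSpace ℝ (Fin 2)) (u : EuclideanSpace ℝ (Fin 2) → ℂ) : Prop :=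
  ∃ ε > 0, ∀ x ∈ Metric.ball x₀ ε, u x = 0

noncomputable def lambda1 (x₀ : EuclideanSpace ℝ (Fin 2)) (ν : ℝ)
    (D : Set (EuclideanSpace ℝ (Fin 2))) : ℝ :=
  sInf {q | ∃ u : EuclideanSpace ℝ (Fin 2) → ℂ, ContDiff ℝ (⊤ : ℕ∞) u ∧ VanishesNear x₀ u ∧
    0 < ∫ x in D, ‖u x‖ ^ 2 ∧
    q = (∫ x in D, magGradSq (AB x₀ ν) u x) / ∫ x in D, ‖u x‖ ^ 2}

noncomputable def sigma1 (x₀ : EuclideanSpace ℝ (Fin 2)) (ν : ℝ)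
    (D : Set (EuclideanSpace ℝ (Fin 2))) : ℝ :=
  sInf {q | ∃ u : EuclideanSpace ℝ (Fin 2) → ℂ, ContDiff ℝ (⊤ : ℕ∞) u ∧ VanishesNear x₀ u ∧
    0 < ∫ x in frontier D, ‖u x‖ ^ 2 ∂(μH[1]) ∧
    q = (∫ x in D, magGradSq (AB x₀ ν) u x) / ∫ x in frontier D, ‖u x‖ ^ 2 ∂(μH[1])}

def HasSmoothBoundary {E : Type*} [NormedAddCommGroup E] [NormedSpace ℝ E] (Ω : Set E) : Prop :=
  ∀ x ∈ frontier Ω, ∃ (f : E → ℝ) (ε : ℝ), 0 < ε ∧ ContDiff ℝ (⊤ : ℕ∞) f ∧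
    fderiv ℝ f x ≠ 0 ∧ ∀ y ∈ Metric.ball x ε, (y ∈ Ω ↔ f y < 0)

noncomputable def distInt (ν : ℝ) : ℝ := ⨅ k : ℤ, |ν - (k : ℝ)|

section EntireSeries

open Set Real
open scoped ContDiff Nat

theorem summable_coeff_mul_pow {a : ℕ → ℝ} {C : ℝ} (ha : ∀ n, |a n| ≤ C / n !) (t : ℝ) :
    Summable fun n => a n * t ^ n := by
  refine Summable.of_norm_bounded ((Real.summable_pow_div_factorial |t|).mul_left C) fun n => ?_
  rw [norm_mul, norm_pow, Real.norm_eq_abs, Real.norm_eq_abs]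
  calc |a n| * |t| ^ n ≤ C / n ! * |t| ^ n := by gcongr; exact ha n
    _ = C * (|t| ^ n / n !) := by ring

theorem abs_deriv_coeff_le {a : ℕ → ℝ} {C : ℝ} (ha : ∀ n, |a n| ≤ C / n !) (n : ℕ) :
    |((n : ℝ) + 1) * a (n + 1)| ≤ C / n ! := by
  have h := ha (n + 1)
  have hn : (0 : ℝ) < (n : ℝ) + 1 := by positivity
  rw [abs_mul, abs_of_pos hn]
  calc ((n : ℝ) + 1) * |a (n + 1)| ≤ (n + 1) * (C / (n + 1)!) := by gcongr
    _ = C / n ! := by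
      rw [Nat.factorial_succ]; push_cast
      field_simp

theorem hasDerivAt_tsum_coeff_mul_pow {a : ℕ → ℝ} {C : ℝ} (ha : ∀ n, |a n| ≤ C / n !) (t : ℝ) :
    HasDerivAt (fun t => ∑' n, a n * t ^ n)
      (∑' n : ℕ, (((n : ℝ) + 1) * a (n + 1)) * t ^ n) t := by
  set ρ := |t| + 1
  have hρ : 0 < ρ := by positivity
  have hu : Summable fun n : ℕ => |a n| * (n * ρ ^ (n - 1)) := by
    rw [← summable_nat_add_iff 1]
    refine Summable.of_norm_bounded ((Real.summable_pow_div_factorial ρ).mul_left C) fun n => ?_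
    have h := abs_deriv_coeff_le ha n
    rw [abs_mul, abs_of_pos (by positivity : (0 : ℝ) < (n : ℝ) + 1)] at h
    rw [Real.norm_of_nonneg (by positivity)]
    simp only [Nat.add_sub_cancel]
    push_cast
    calc |a (n + 1)| * (((n : ℝ) + 1) * ρ ^ n) = ((n + 1) * |a (n + 1)|) * ρ ^ n := by ring
      _ ≤ C / n ! * ρ ^ n := by gcongr
      _ = C * (ρ ^ n / n !) := by ring
  have key := hasDerivAt_tsum_of_isPreconnected (𝕜 := ℝ) (g := fun n t => a n * t ^ n)
    (g' := fun n t => a n * (n * t ^ (n - 1))) (t := Metric.ball (0 : ℝ) ρ) (y₀ := 0) (y := t)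
    hu Metric.isOpen_ball (convex_ball (0 : ℝ) ρ).isPreconnected
    (fun n y _ => (hasDerivAt_pow n y).const_mul (a n))
    (fun n y hy => by
      have hy' : |y| ≤ ρ := by simpa using (Metric.mem_ball.1 hy).le
      rw [norm_mul, norm_mul, norm_pow, Real.norm_eq_abs, Real.norm_eq_abs, Real.norm_eq_abs,
        Nat.abs_cast]
      gcongr)
    (Metric.mem_ball_self hρ) (summable_coeff_mul_pow ha 0)
    (by simp [ρ])
  refine key.congr_deriv ?_
  have hs : Summable fun n : ℕ => a n * (n * t ^ (n - 1)) := by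
    refine Summable.of_norm_bounded hu fun n => ?_
    rw [norm_mul, norm_mul, norm_pow, Real.norm_eq_abs, Real.norm_eq_abs, Real.norm_eq_abs,
      Nat.abs_cast]
    gcongr
    simp [ρ]
  rw [hs.tsum_eq_zero_add]
  simp only [CharP.cast_eq_zero, zero_mul, mul_zero, zero_add, Nat.add_sub_cancel]
  refine tsum_congr fun n => ?_
  push_cast
  ring

theorem contDiff_tsum_coeff_mul_pow {a : ℕ → ℝ} {C : ℝ} (ha : ∀ n, |a n| ≤ C / n !) :
    ContDiff ℝ ∞ fun t => ∑' n, a n * t ^ n := by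
  refine contDiff_infty.2 fun m => ?_
  induction m generalizing a with
  | zero =>
    exact contDiff_zero.2 (continuous_iff_continuousAt.2 fun t =>
      (hasDerivAt_tsum_coeff_mul_pow ha t).continuousAt)
  | succ m ih =>
    push_cast
    refine contDiff_succ_iff_deriv.2
      ⟨fun t => (hasDerivAt_tsum_coeff_mul_pow ha t).differentiableAt, by simp, ?_⟩
    rw [funext fun t => (hasDerivAt_tsum_coeff_mul_pow ha t).deriv]
    exact ih (abs_deriv_coeff_le ha)

/-- Taylor coefficients of `t ↦ Γ(d+1) t^(-d/2) J_d(2√t)`. -/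
noncomputable def besselCoeff (d : ℝ) : ℕ → ℝ
  | 0 => 1
  | n + 1 => -besselCoeff d n / ((n + 1) * (n + 1 + d))

theorem abs_besselCoeff_le {d : ℝ} (hd : 0 < d) (n : ℕ) : |besselCoeff d n| ≤ 1 / n ! := by
  induction n with
  | zero => simp [besselCoeff]
  | succ n ih =>
    have h1 : (0 : ℝ) < (n + 1) * (n + 1 + d) := by positivity
    rw [besselCoeff, abs_div, abs_neg, abs_of_pos h1, div_le_iff₀ h1, Nat.factorial_succ]
    refine ih.trans ?_
    push_cast
    have h2 : (1 : ℝ) / (((n : ℝ) + 1) * n !) * ((n + 1) * (n + 1 + d))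
      = 1 / n ! * (n + 1 + d) := by field_simp
    rw [h2]
    refine le_mul_of_one_le_right (by positivity) ?_
    have : (0 : ℝ) ≤ n := by positivity
    linarith

/-- For `0 < d`, an entire solution of `t g'' + (1 + d) g' + g = 0` together with its
derivatives; `k = d g + 2 t g'` becomes negative at `t = d ≤ 1 / 2`. -/
theorem exists_entire_bessel {d : ℝ} (hd : 0 < d) (hd2 : d ≤ 1 / 2) :
    ∃ g g' g'' : ℝ → ℝ, ContDiff ℝ ∞ g ∧ g 0 = 1 ∧ (∀ t, HasDerivAt g (g' t) t) ∧
      (∀ t, HasDerivAt g' (g'' t) t) ∧ (∀ t, t * g'' t + (1 + d) * g' t + g t = 0) ∧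
      d * g d + 2 * d * g' d < 0 := by
  set a := besselCoeff d
  have ha := abs_besselCoeff_le hd
  have ha' := abs_deriv_coeff_le ha
  have ha'' := abs_deriv_coeff_le ha'
  have hrec : ∀ n : ℕ, ((n : ℝ) + 1) * (n + 1 + d) * a (n + 1) = -a n := fun n => by
    have h1 : ((n : ℝ) + 1) * (n + 1 + d) ≠ 0 := by positivity
    simp only [a, besselCoeff]
    field_simp
  have shift : ∀ (b : ℕ → ℝ) (_ : ∀ n, |b n| ≤ 1 / n !) (t : ℝ),
      t * ∑' n : ℕ, (((n : ℝ) + 1) * b (n + 1)) * t ^ n = ∑' n : ℕ, (n * b n) * t ^ n := by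
    intro b hb t
    have hs : Summable fun n : ℕ => (n * b n) * t ^ n := by
      rw [← summable_nat_add_iff 1]
      refine ((summable_coeff_mul_pow (abs_deriv_coeff_le hb) t).mul_left t).congr fun n => ?_
      push_cast; ring
    rw [hs.tsum_eq_zero_add, ← tsum_mul_left]
    simp only [CharP.cast_eq_zero, zero_mul, zero_add]
    refine tsum_congr fun n => ?_
    push_cast; ring
  have shiftS : ∀ (b : ℕ → ℝ) (_ : ∀ n, |b n| ≤ 1 / n !) (t : ℝ),
      Summable fun n : ℕ => (n * b n) * t ^ n := by
    intro b hb t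
    rw [← summable_nat_add_iff 1]
    refine ((summable_coeff_mul_pow (abs_deriv_coeff_le hb) t).mul_left t).congr fun n => ?_
    push_cast; ring
  refine ⟨_, _, _, contDiff_tsum_coeff_mul_pow ha, ?_, hasDerivAt_tsum_coeff_mul_pow ha,
    hasDerivAt_tsum_coeff_mul_pow ha', fun t => ?_, ?_⟩
  · rw [tsum_eq_single 0 (fun n hn => by simp [hn])]
    simp [besselCoeff]
  · rw [shift _ ha' t, ← tsum_mul_left, ← Summable.tsum_add, ← Summable.tsum_add]
    · rw [← tsum_zero (α := ℝ) (β := ℕ)]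
      refine tsum_congr fun n => ?_
      linear_combination t ^ n * hrec n
    · exact (shiftS _ ha' t).add ((summable_coeff_mul_pow ha' t).mul_left _)
    · exact summable_coeff_mul_pow ha t
    · exact shiftS _ ha' t
    · exact (summable_coeff_mul_pow ha' t).mul_left _
  · set c : ℕ → ℝ := fun n => (d + 2 * n) * a n
    have hc : ∀ n : ℕ, |c (n + 2)| ≤ (1 / 3) ^ n := by
      have step : ∀ n : ℕ, c (n + 1) * ((d + 2 * n) * ((n + 1) * (n + 1 + d)))
          = -(c n * (d + 2 * n + 2)) := fun n => by
        simp only [c]; push_cast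
        linear_combination (d + 2 * n) * (d + 2 * (n + 1)) * hrec n
      intro n
      induction n with
      | zero =>
        have h0 : a 0 = 1 := rfl
        have h1 := hrec 0
        have h2 := hrec 1
        simp only [CharP.cast_eq_zero, zero_add, one_mul, h0, Nat.cast_one] at h1 h2
        have h3 : (1 + 1) * (1 + 1 + d) * (1 + d) * a 2 = 1 := by
          linear_combination (1 + d) * h2 - h1
        have h4 : a 2 = 1 / ((1 + 1) * (1 + 1 + d) * (1 + d)) := by
          rw [eq_div_iff (by positivity)]; linarith
        simp only [c, zero_add, pow_zero, h4]
        rw [abs_of_pos (by positivity), mul_one_div, div_le_one (by positivity)]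
        push_cast
        nlinarith
      | succ n ih =>
        have h := congrArg abs (step (n + 2))
        push_cast at h
        have hn : (0 : ℝ) ≤ n := by positivity
        rw [abs_neg, abs_mul (c _), abs_mul (c _), abs_of_pos (by positivity :
          (0 : ℝ) < (d + 2 * (n + 2)) * ((n + 2 + 1) * (n + 2 + 1 + d))),
          abs_of_pos (by positivity : (0 : ℝ) < d + 2 * (n + 2) + 2)] at h
        have h5 : 3 * (d + 2 * ((n : ℝ) + 2) + 2) ≤
            (d + 2 * (n + 2)) * ((n + 2 + 1) * (n + 2 + 1 + d)) := by
          have : (9 : ℝ) ≤ ((n : ℝ) + 2 + 1) * (n + 2 + 1 + d) := by nlinarith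
          nlinarith
        have h6 : |c (n + 1 + 2)| * (3 * (d + 2 * ((n : ℝ) + 2) + 2))
            ≤ |c (n + 2)| * (d + 2 * (n + 2) + 2) := by
          rw [← h]; exact mul_le_mul_of_nonneg_left h5 (abs_nonneg _)
        have h7 : |c (n + 1 + 2)| * 3 ≤ |c (n + 2)| := by
          refine le_of_mul_le_mul_right ?_ (by positivity : (0 : ℝ) < d + 2 * (n + 2) + 2)
          linarith
        rw [pow_succ]
        linarith
    have hsum : Summable fun n => c n * d ^ n := by
      have := ((summable_coeff_mul_pow ha d).mul_left d).add ((shiftS _ ha d).mul_left 2)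
      refine this.congr fun n => ?_
      simp only [c]; ring
    have heq : d * ∑' n, a n * d ^ n + 2 * d * ∑' n : ℕ, (((n : ℝ) + 1) * a (n + 1)) * d ^ n
        = ∑' n, c n * d ^ n := by
      rw [mul_assoc 2, shift _ ha d, ← tsum_mul_left, ← tsum_mul_left, ← Summable.tsum_add]
      · refine tsum_congr fun n => ?_
        simp only [c]; ring
      · exact (summable_coeff_mul_pow ha d).mul_left d
      · exact (shiftS _ ha d).mul_left 2
    rw [heq, ← hsum.sum_add_tsum_nat_add 2]
    have hgeo : HasSum (fun n : ℕ => d ^ 2 * (1 / 6 : ℝ) ^ n) (d ^ 2 * (6 / 5)) := by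
      have := (hasSum_geometric_of_lt_one (by norm_num : (0 : ℝ) ≤ 1 / 6) (by norm_num)).mul_left
        (d ^ 2)
      norm_num at this ⊢
      exact this
    have htail : ∑' n, c (n + 2) * d ^ (n + 2) ≤ d ^ 2 * (6 / 5) := by
      rw [← hgeo.tsum_eq]
      refine ((summable_nat_add_iff 2).2 hsum).tsum_le_tsum (fun n => ?_) hgeo.summable
      calc c (n + 2) * d ^ (n + 2) ≤ |c (n + 2)| * d ^ (n + 2) := by
            gcongr; exact le_abs_self _
        _ ≤ (1 / 3) ^ n * ((1 / 2) ^ n * d ^ 2) := by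
            rw [pow_add]; gcongr; exact hc n
        _ = d ^ 2 * (1 / 6) ^ n := by
            rw [show (1 / 6 : ℝ) = 1 / 3 * (1 / 2) by norm_num, mul_pow]; ring
    have h1 := hrec 0
    have h0 : a 0 = 1 := rfl
    simp only [CharP.cast_eq_zero, zero_add, one_mul, h0] at h1
    have h2 : a 1 = -1 / (1 + d) := by rw [eq_div_iff (by positivity)]; linarith
    have h3 : ∑ n ∈ Finset.range 2, c n * d ^ n = -d / (1 + d) := by
      simp only [Finset.sum_range_succ, Finset.sum_range_zero, c, h0, h2]
      push_cast
      field_simp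
      ring
    rw [h3]
    have h4 : -d / (1 + d) + d ^ 2 * (6 / 5) < 0 := by
      rw [div_add' _ _ _ (by positivity)]
      apply div_neg_of_neg_of_pos _ (by positivity)
      nlinarith [mul_pos hd hd]
    linarith

end EntireSeries

section Profile

open Set Real
open scoped ContDiff

/-- `f` is a positive increasing solution, with derivative `f₁`, of the radial equation
`f'' + f' / r + (Λ - d² / r²) f = 0` on `(0, R]` with a Neumann condition at `R`. -/
structure RadialProfile (d R Λ : ℝ) (f f₁ : ℝ → ℝ) : Prop where
  contDiffOn : ContDiffOn ℝ ∞ f (Ioi 0)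
  hasDerivAt : ∀ r, 0 < r → HasDerivAt f (f₁ r) r
  hasDerivAt₁ : ∀ r, 0 < r → HasDerivAt f₁ (-f₁ r / r + d ^ 2 * f r / r ^ 2 - Λ * f r) r
  pos : ∀ r, 0 < r → r ≤ R → 0 < f r
  nonneg₁ : ∀ r, 0 < r → r ≤ R → 0 ≤ f₁ r
  neumann : f₁ R = 0
  bound : ∃ C, 0 ≤ C ∧ ∀ r, 0 < r → r ≤ R → f r ≤ C * r ^ d ∧ f₁ r ≤ C * r ^ (d - 1)

theorem exists_radialProfile {d R : ℝ} (hd : 0 < d) (hd2 : d ≤ 1 / 2) (hR : 0 < R) :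
    ∃ (Λ : ℝ) (f f₁ : ℝ → ℝ), 0 < Λ ∧ Λ ≤ 4 * d / R ^ 2 ∧ RadialProfile d R Λ f f₁ := by
  obtain ⟨g, g', g'', hg, hg0, hgd, hgd', hode, hneg⟩ := exists_entire_bessel hd hd2
  set k : ℝ → ℝ := fun t => d * g t + 2 * t * g' t with hk
  have hgc : Continuous g := hg.continuous
  have hgc' : Continuous g' := continuous_iff_continuousAt.2 fun t => (hgd' t).continuousAt
  have hkc : Continuous k := by fun_prop
  have hkd : ∀ t, HasDerivAt k (d * g' t + (2 * g' t + 2 * t * g'' t)) t := fun t => by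
    have h := ((hgd t).const_mul d).add (((hasDerivAt_id t).const_mul 2).mul (hgd' t))
    exact h.congr_deriv (by simp)
  have hSne : (Icc 0 d ∩ k ⁻¹' Iic 0).Nonempty := ⟨d, ⟨hd.le, le_rfl⟩, hneg.le⟩
  obtain ⟨τ, ⟨⟨hτ0, hτd⟩, hkτ⟩, hmin⟩ :=
    (isCompact_Icc.inter_right (isClosed_Iic.preimage hkc)).exists_isLeast hSne
  have hk0 : 0 < k 0 := by simp [hk, hg0, hd]
  have hτ : 0 < τ := by
    rcases hτ0.eq_or_lt with h | h
    · rw [← h] at hkτ; exact absurd hkτ (not_le.2 hk0)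
    · exact h
  have hkpos : ∀ t, 0 ≤ t → t < τ → 0 < k t := fun t h0 ht => by
    by_contra hcon
    exact absurd (hmin ⟨⟨h0, ht.le.trans hτd⟩, not_lt.1 hcon⟩) (not_le.2 ht)
  have hkτ0 : k τ = 0 := by
    refine le_antisymm hkτ ?_
    have : τ ∈ closure (Ico 0 τ) := by rw [closure_Ico hτ.ne]; exact ⟨hτ0, le_rfl⟩
    refine closure_minimal (fun t ht => ?_) (isClosed_Ici.preimage hkc) this
    exact (hkpos t ht.1 ht.2).le
  set c := τ / R ^ 2 with hc
  have hc0 : 0 < c := by positivity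
  have hcR : c * R ^ 2 = τ := by rw [hc]; field_simp
  have hcr : ∀ r, 0 < r → r < R → c * r ^ 2 < τ := fun r h0 h => by
    rw [← hcR]; gcongr
  have hf : ∀ r, 0 < r →
      HasDerivAt (fun r : ℝ => r ^ d * g (c * r ^ 2)) (r ^ (d - 1) * k (c * r ^ 2)) r := by
    intro r hr
    have h1 : HasDerivAt (fun r : ℝ => c * r ^ 2) (c * (2 * r)) r := by
      simpa using (hasDerivAt_pow 2 r).const_mul c
    have h := (Real.hasDerivAt_rpow_const (p := d) (Or.inl hr.ne')).mul
      ((hgd (c * r ^ 2)).comp r h1)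
    refine h.congr_deriv ?_
    have : r ^ d = r ^ (d - 1) * r := by rw [← rpow_add_one hr.ne']; simp
    simp only [hk, Function.comp, this]
    ring
  have hmono : StrictMonoOn (fun r : ℝ => r ^ d * g (c * r ^ 2)) (Icc 0 R) := by
    refine strictMonoOn_of_deriv_pos (convex_Icc 0 R) ?_ fun r hr => ?_
    · exact ((Real.continuous_rpow_const hd.le).mul (hgc.comp (by fun_prop))).continuousOn
    · rw [interior_Icc] at hr
      rw [(hf r hr.1).deriv]
      have := hkpos (c * r ^ 2) (by positivity) (hcr r hr.1 hr.2)
      have := rpow_pos_of_pos hr.1 (d - 1)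
      positivity
  refine ⟨4 * c, fun r => r ^ d * g (c * r ^ 2), fun r => r ^ (d - 1) * k (c * r ^ 2),
    by positivity, ?_, ?_, hf, fun r hr => ?_, fun r hr hrR => ?_, fun r hr hrR => ?_, ?_, ?_⟩
  · rw [hc, mul_div_assoc]; gcongr
  · refine ContDiffOn.mul (fun r hr => ?_) (hg.comp (by fun_prop)).contDiffOn
    exact (Real.contDiffAt_rpow_const_of_ne (ne_of_gt hr)).contDiffWithinAt
  · have h1 : HasDerivAt (fun r : ℝ => c * r ^ 2) (c * (2 * r)) r := by
      simpa using (hasDerivAt_pow 2 r).const_mul c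
    have h := (Real.hasDerivAt_rpow_const (p := d - 1) (Or.inl hr.ne')).mul
      ((hkd (c * r ^ 2)).comp r h1)
    refine h.congr_deriv ?_
    have e1 : r ^ (d - 1) = r ^ (d - 1 - 1) * r := by rw [← rpow_add_one hr.ne']; simp
    have e2 : r ^ d = r ^ (d - 1 - 1) * r ^ 2 := by
      rw [← rpow_natCast, ← rpow_add hr]; congr 1; push_cast; ring
    have e3 : r ^ d / r ^ 2 = r ^ (d - 1 - 1) := by rw [e2]; field_simp
    have e4 : -(r ^ (d - 1) * k (c * r ^ 2)) / r = -(r ^ (d - 1 - 1) * k (c * r ^ 2)) := by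
      rw [e1]; field_simp
    have e5 : d ^ 2 * (r ^ d * g (c * r ^ 2)) / r ^ 2
        = d ^ 2 * (r ^ (d - 1 - 1) * g (c * r ^ 2)) := by rw [e2]; field_simp
    rw [e4, e5, e1, e2]
    simp only [hk, Function.comp]
    linear_combination (4 * c * r ^ 2 * r ^ (d - 1 - 1)) * hode (c * r ^ 2)
  · have := hmono ⟨le_rfl, hR.le⟩ ⟨hr.le, hrR⟩ hr
    simpa [Real.zero_rpow hd.ne'] using this
  · refine mul_nonneg (rpow_nonneg hr.le _) ?_
    rcases hrR.eq_or_lt with rfl | h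
    · rw [hcR, hkτ0]
    · exact (hkpos _ (by positivity) (hcr r hr h)).le
  · simp only [hcR, hkτ0, mul_zero]
  · obtain ⟨C₁, hC₁⟩ := (isCompact_Icc (a := 0) (b := τ)).exists_bound_of_continuousOn
      hgc.continuousOn
    obtain ⟨C₂, hC₂⟩ := (isCompact_Icc (a := 0) (b := τ)).exists_bound_of_continuousOn
      hkc.continuousOn
    have h0 : 0 ≤ C₁ := (norm_nonneg _).trans (hC₁ 0 ⟨le_rfl, hτ0⟩)
    refine ⟨max C₁ C₂, le_max_of_le_left h0, fun r hr hrR => ?_⟩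
    have hm : c * r ^ 2 ∈ Icc 0 τ := ⟨by positivity, by rw [← hcR]; gcongr⟩
    have p1 := rpow_nonneg hr.le d
    have p2 := rpow_nonneg hr.le (d - 1)
    refine ⟨?_, ?_⟩
    · rw [mul_comm]
      gcongr
      exact (le_abs_self _).trans ((hC₁ _ hm).trans (le_max_left _ _))
    · rw [mul_comm]
      gcongr
      exact (le_abs_self _).trans ((hC₂ _ hm).trans (le_max_right _ _))

namespace RadialProfile

variable {d R Λ : ℝ} {f f₁ : ℝ → ℝ}

/-- The energy density minus `Λ` times the mass density of the profile, continued by the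
constant `f R` beyond `R`. -/
noncomputable def excess (d R Λ : ℝ) (f f₁ : ℝ → ℝ) (r : ℝ) : ℝ :=
  f₁ (min r R) ^ 2 + d ^ 2 * f (min r R) ^ 2 / r ^ 2 - Λ * f (min r R) ^ 2

theorem excess_le (hR : 0 < R) {r : ℝ}
    (hr : R ≤ r) : excess d R Λ f f₁ r ≤ excess d R Λ f f₁ R := by
  simp only [excess, min_eq_right hr, min_self]
  gcongr

theorem hasDerivAt_density (h : RadialProfile d R Λ f f₁) {r : ℝ} (hr : 0 < r) :
    HasDerivAt (fun r => f₁ r ^ 2 + d ^ 2 * f r ^ 2 / r ^ 2 - Λ * f r ^ 2)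
      (-4 * Λ * f r * f₁ r - 2 / r * ((f₁ r - d ^ 2 * f r / r) ^ 2
        + d ^ 2 * (1 - d ^ 2) * f r ^ 2 / r ^ 2)) r := by
  have h1 := (h.hasDerivAt₁ r hr).pow 2
  have h2 := (((h.hasDerivAt r hr).pow 2).const_mul (d ^ 2)).div (hasDerivAt_pow 2 r)
    (by positivity)
  have h3 := ((h.hasDerivAt r hr).pow 2).const_mul Λ
  refine ((h1.add h2).sub h3).congr_deriv ?_
  simp only [Pi.pow_apply]
  field_simp
  push_cast
  ring

theorem le_excess (h : RadialProfile d R Λ f f₁) (hΛ : 0 < Λ) (hd2 : d ^ 2 ≤ 1) {r : ℝ}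
    (hr : 0 < r) (hrR : r ≤ R) : excess d R Λ f f₁ R ≤ excess d R Λ f f₁ r := by
  have hR : 0 < R := hr.trans_le hrR
  have hanti : AntitoneOn (fun r => f₁ r ^ 2 + d ^ 2 * f r ^ 2 / r ^ 2 - Λ * f r ^ 2)
      (Icc r R) := by
    refine antitoneOn_of_deriv_nonpos (convex_Icc r R) (fun s hs => ?_) (fun s hs => ?_)
      fun s hs => ?_
    · exact (h.hasDerivAt_density (hr.trans_le hs.1)).continuousAt.continuousWithinAt
    · rw [interior_Icc] at hs
      exact (h.hasDerivAt_density (hr.trans hs.1)).differentiableAt.differentiableWithinAt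
    · rw [interior_Icc] at hs
      have hs0 := hr.trans hs.1
      rw [(h.hasDerivAt_density hs0).deriv]
      have p1 := (h.pos s hs0 hs.2.le).le
      have p2 := h.nonneg₁ s hs0 hs.2.le
      have p3 : 0 ≤ 4 * Λ * f s * f₁ s := by positivity
      have p4 : 0 ≤ 1 - d ^ 2 := by linarith
      have p5 : 0 ≤ 2 / s * ((f₁ s - d ^ 2 * f s / s) ^ 2
        + d ^ 2 * (1 - d ^ 2) * f s ^ 2 / s ^ 2) := by positivity
      linarith
  have := hanti ⟨le_rfl, hrR⟩ ⟨hrR, le_rfl⟩ hrR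
  simpa only [excess, min_eq_left hrR, min_self] using this

end RadialProfile

end Profile

section Angular

open Set Real

theorem fourierCoeffOn_of_hasDerivAt_of_periodic {a b : ℝ} (hab : a < b) {v v' : ℝ → ℂ}
    (hv : ∀ θ, HasDerivAt v (v' θ) θ) (hv' : Continuous v') (hper : v a = v b) (n : ℤ) :
    fourierCoeffOn hab v' n = 2 * π * Complex.I * n / (b - a) * fourierCoeffOn hab v n := by
  have hba : ((b : ℂ) - a) ≠ 0 := by exact_mod_cast (sub_pos.2 hab).ne'
  rcases eq_or_ne n 0 with rfl | hn
  · have := intervalIntegral.integral_eq_sub_of_hasDerivAt (fun θ _ => hv θ)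
      (hv'.intervalIntegrable a b)
    simp [fourierCoeffOn_eq_integral, this, hper]
  · have h := fourierCoeffOn_of_hasDerivAt hab hn (fun θ _ => hv θ) (hv'.intervalIntegrable a b)
    have hn' : (n : ℂ) ≠ 0 := by exact_mod_cast hn
    have hpi : (π : ℂ) ≠ 0 := by exact_mod_cast pi_ne_zero
    rw [h, hper]
    field_simp [Complex.I_ne_zero]
    ring

theorem fourierCoeffOn_sub_const_mul {a b : ℝ} (hab : a < b) {v w : ℝ → ℂ} (hv : Continuous v)
    (hw : Continuous w) (c : ℂ) (n : ℤ) :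
    fourierCoeffOn hab (fun θ => v θ - c * w θ) n
      = fourierCoeffOn hab v n - c * fourierCoeffOn hab w n := by
  have hF : Continuous fun x : ℝ => (fourier (-n) (x : AddCircle (b - a)) : ℂ) :=
    (map_continuous _).comp (AddCircle.continuous_mk' _)
  simp only [fourierCoeffOn_eq_integral, smul_eq_mul, Complex.real_smul]
  rw [mul_left_comm c, ← mul_sub]
  congr 1
  rw [← intervalIntegral.integral_const_mul, ← intervalIntegral.integral_sub]
  · congr 1
    ext x
    ring
  · exact (hF.mul hv).intervalIntegrable _ _
  · exact (continuous_const.mul (hF.mul hw)).intervalIntegrable _ _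

/-- Wirtinger's inequality for the magnetic derivative on the circle. -/
theorem magnetic_wirtinger {d ν : ℝ} (hd : 0 ≤ d) (hν : ∀ m : ℤ, d ≤ |ν - m|) {v v' : ℝ → ℂ}
    (hv : ∀ θ, HasDerivAt v (v' θ) θ) (hv' : Continuous v') (hper : v (-π) = v π) :
    d ^ 2 * ∫ θ in -π..π, ‖v θ‖ ^ 2 ≤ ∫ θ in -π..π, ‖v' θ - Complex.I * ν * v θ‖ ^ 2 := by
  have hpi : -π < π := by linarith [pi_pos]
  have hvc : Continuous v := continuous_iff_continuousAt.2 fun θ => (hv θ).continuousAt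
  have hwc : Continuous fun θ => v' θ - Complex.I * ν * v θ := by fun_prop
  have hL : ∀ g : ℝ → ℂ, Continuous g → MemLp g 2 (volume.restrict (Ioc (-π) π)) := fun g hg =>
    (memLp_two_iff_integrable_sq_norm hg.aestronglyMeasurable).2
      ((hg.norm.pow 2).integrableOn_Ioc)
  have h1 := (hasSum_sq_fourierCoeffOn hpi (hL _ hvc)).mul_left (d ^ 2)
  have h2 := hasSum_sq_fourierCoeffOn hpi (hL _ hwc)
  have h3 := hasSum_le (fun n => ?_) h1 h2
  · rw [smul_eq_mul, smul_eq_mul, mul_left_comm] at h3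
    exact le_of_mul_le_mul_left h3 (inv_pos.2 (by linarith [pi_pos]))
  · have hpi' : (π : ℂ) ≠ 0 := by exact_mod_cast pi_ne_zero
    rw [fourierCoeffOn_sub_const_mul hpi hv' hvc,
      fourierCoeffOn_of_hasDerivAt_of_periodic hpi hv hv' hper]
    have e : 2 * π * Complex.I * n / ((π : ℝ) - (-π : ℝ) : ℂ) * fourierCoeffOn hpi v n
        - Complex.I * ν * fourierCoeffOn hpi v n
        = Complex.I * ((n - ν : ℝ) : ℂ) * fourierCoeffOn hpi v n := by
      push_cast
      field_simp
      ring
    rw [e, norm_mul, norm_mul, Complex.norm_I, one_mul, Complex.norm_real, mul_pow]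
    have := hν n
    rw [abs_sub_comm] at this
    rw [Real.norm_eq_abs]
    gcongr

end Angular

section Radial

open Set Real

theorem RadialProfile.picone {d R Λ : ℝ} {f f₁ : ℝ → ℝ} (h : RadialProfile d R Λ f f₁)
    {ε : ℝ} (hε : 0 < ε) (hεR : ε ≤ R) {U U' : ℝ → ℂ} (hU : ∀ r, HasDerivAt U (U' r) r)
    (hU' : Continuous U') (hUε : U ε = 0) :
    0 ≤ ∫ r in ε..R, (r * ‖U' r‖ ^ 2 + d ^ 2 / r * ‖U r‖ ^ 2 - Λ * (r * ‖U r‖ ^ 2)) := by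
  have hUc : Continuous U := continuous_iff_continuousAt.2 fun r => (hU r).continuousAt
  set η : ℝ → ℝ := fun r => f₁ r / f r with hη
  set Ψ' : ℝ → ℝ := fun r => (d ^ 2 / r - Λ * r - r * η r ^ 2) * ‖U r‖ ^ 2
    + r * η r * (2 * inner ℝ (U r) (U' r)) with hΨ'
  have hd : ∀ r ∈ uIcc ε R, HasDerivAt (fun r => r * η r * ‖U r‖ ^ 2) (Ψ' r) r := by
    intro r hr
    rw [uIcc_of_le hεR] at hr
    have hr0 : 0 < r := hε.trans_le hr.1
    have hf := (h.pos r hr0 hr.2).ne'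
    have h1 := ((hasDerivAt_id r).mul ((h.hasDerivAt₁ r hr0).div (h.hasDerivAt r hr0) hf)).mul
      (hU r).norm_sq
    refine h1.congr_deriv ?_
    simp only [hΨ', hη, id, Pi.mul_apply, Pi.div_apply]
    field_simp
    ring
  have hηc : ContinuousOn η (uIcc ε R) := fun r hr => by
    rw [uIcc_of_le hεR] at hr
    have hr0 : 0 < r := hε.trans_le hr.1
    exact ((h.hasDerivAt₁ r hr0).continuousAt.div (h.hasDerivAt r hr0).continuousAt
      (h.pos r hr0 hr.2).ne').continuousWithinAt
  have hne : ∀ r ∈ uIcc ε R, r ≠ 0 := fun r hr => by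
    rw [uIcc_of_le hεR] at hr
    exact (hε.trans_le hr.1).ne'
  have hinv : ContinuousOn (fun r : ℝ => d ^ 2 / r) (uIcc ε R) :=
    continuousOn_const.div continuousOn_id hne
  have hΨc : ContinuousOn Ψ' (uIcc ε R) := by
    have hi : Continuous fun r => inner ℝ (U r) (U' r) := hUc.inner hU'
    fun_prop
  have hint := intervalIntegral.integral_eq_sub_of_hasDerivAt hd hΨc.intervalIntegrable
  have hz : R * η R * ‖U R‖ ^ 2 - ε * η ε * ‖U ε‖ ^ 2 = 0 := by
    simp [hη, h.neumann, hUε]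
  rw [hz] at hint
  rw [← hint]
  refine intervalIntegral.integral_mono_on hεR hΨc.intervalIntegrable
    (ContinuousOn.intervalIntegrable (by fun_prop)) fun r hr => ?_
  have hr0 : 0 < r := hε.trans_le hr.1
  have hsq : ‖U' r - (η r) • U r‖ ^ 2
      = ‖U' r‖ ^ 2 - 2 * (η r * inner ℝ (U r) (U' r)) + η r ^ 2 * ‖U r‖ ^ 2 := by
    rw [norm_sub_sq_real, inner_smul_right, real_inner_comm, norm_smul, mul_pow,
      Real.norm_eq_abs, sq_abs]
  have : 0 ≤ r * ‖U' r - (η r) • U r‖ ^ 2 := by positivity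
  rw [hsq] at this
  simp only [hΨ']
  nlinarith

end Radial

section LowerBound

open Set Real Metric
open scoped ContDiff

/-- Polar coordinates centred at `x₀`. -/
noncomputable def polarPoint (x₀ : EuclideanSpace ℝ (Fin 2)) (q : ℝ × ℝ) :
    EuclideanSpace ℝ (Fin 2) :=
  x₀ + !₂[q.1 * cos q.2, q.1 * sin q.2]

theorem norm_polarPoint_sub (x₀ : EuclideanSpace ℝ (Fin 2)) {q : ℝ × ℝ} (hq : 0 ≤ q.1) :
    ‖polarPoint x₀ q - x₀‖ = q.1 := by
  rw [polarPoint, add_sub_cancel_left, EuclideanSpace.norm_eq, Fin.sum_univ_two]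
  simp only [Matrix.cons_val_zero, Matrix.cons_val_one, Real.norm_eq_abs, sq_abs,
    Matrix.cons_val_fin_one]
  rw [mul_pow, mul_pow, ← mul_add, cos_sq_add_sin_sq, mul_one, sqrt_sq hq]

theorem integral_eq_polar (x₀ : EuclideanSpace ℝ (Fin 2)) (Φ : EuclideanSpace ℝ (Fin 2) → ℝ) :
    ∫ x, Φ x = ∫ q in polarCoord.target, q.1 * Φ (polarPoint x₀ q) := by
  rw [← integral_add_left_eq_self Φ x₀,
    ← (EuclideanSpace.volume_preserving_symm_measurableEquiv_toLp (Fin 2)).symm.integral_comp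
      (MeasurableEquiv.measurableEmbedding _),
    ← (volume_preserving_finTwoArrow ℝ).symm.integral_comp (MeasurableEquiv.measurableEmbedding _),
    ← integral_comp_polarCoord_symm]
  refine setIntegral_congr_fun polarCoord.open_target.measurableSet fun q _ => ?_
  simp only [smul_eq_mul]
  congr 2

theorem setIntegral_ball_eq_polar (x₀ : EuclideanSpace ℝ (Fin 2)) {ε R : ℝ}
    {Φ : EuclideanSpace ℝ (Fin 2) → ℝ} (hΦ : ∀ x ∈ ball x₀ ε, Φ x = 0) {ε' : ℝ} (hε'0 : 0 < ε')
    (hε' : ε' < ε) :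
    ∫ x in ball x₀ R, Φ x =
      ∫ q in Ioo ε' R ×ˢ Ioo (-π) π, q.1 * Φ (polarPoint x₀ q) := by
  have hS : MeasurableSet (Ioo ε' R ×ˢ Ioo (-π) π) := measurableSet_Ioo.prod measurableSet_Ioo
  rw [← integral_indicator measurableSet_ball, integral_eq_polar x₀]
  refine (setIntegral_eq_of_subset_of_forall_sdiff_eq_zero (s := Ioo ε' R ×ˢ Ioo (-π) π)
    polarCoord.open_target.measurableSet ?_ ?_).trans ?_
  · exact fun q hq => ⟨hε'0.trans hq.1.1, hq.2⟩
  · rintro q ⟨hq, hq'⟩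
    have h0 : 0 < q.1 := hq.1
    have hd : dist (polarPoint x₀ q) x₀ = q.1 := by
      rw [dist_eq_norm, norm_polarPoint_sub x₀ h0.le]
    by_cases hR : q.1 < R
    · have : q.1 ≤ ε' := by
        by_contra hcon
        exact hq' ⟨⟨not_le.1 hcon, hR⟩, hq.2⟩
      have hz := hΦ (polarPoint x₀ q) (by rw [mem_ball, hd]; exact this.trans_lt hε')
      simp [indicator, hz]
    · have : polarPoint x₀ q ∉ ball x₀ R := by rw [mem_ball, hd]; exact hR
      simp [indicator_of_notMem this]
  · refine setIntegral_congr_fun hS fun q hq => ?_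
    have h0 : 0 < q.1 := hε'0.trans hq.1.1
    have hm : polarPoint x₀ q ∈ ball x₀ R := by
      rw [mem_ball, dist_eq_norm, norm_polarPoint_sub x₀ h0.le]; exact hq.1.2
    simp only [indicator_of_mem hm]

theorem hasDerivAt_polarPoint_fst (x₀ : EuclideanSpace ℝ (Fin 2)) (r θ : ℝ) :
    HasDerivAt (fun r => polarPoint x₀ (r, θ)) !₂[cos θ, sin θ] r := by
  have h : (fun r => polarPoint x₀ (r, θ)) = fun r => x₀ + r • !₂[cos θ, sin θ] := by
    ext r i
    fin_cases i <;> simp [polarPoint]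
  rw [h]
  simpa using ((hasDerivAt_id r).smul_const !₂[cos θ, sin θ]).const_add x₀

theorem hasDerivAt_polarPoint_snd (x₀ : EuclideanSpace ℝ (Fin 2)) (r θ : ℝ) :
    HasDerivAt (fun θ => polarPoint x₀ (r, θ)) !₂[-(r * sin θ), r * cos θ] θ := by
  have h : (fun θ => polarPoint x₀ (r, θ)) = fun θ =>
      x₀ + ((r * cos θ) • !₂[(1 : ℝ), 0] + (r * sin θ) • !₂[(0 : ℝ), 1]) := by
    ext r i
    fin_cases i <;> simp [polarPoint]
  rw [h]
  refine (((((hasDerivAt_cos θ).const_mul r).smul_const !₂[(1 : ℝ), 0]).add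
    (((hasDerivAt_sin θ).const_mul r).smul_const !₂[(0 : ℝ), 1])).const_add x₀).congr_deriv ?_
  ext i
  fin_cases i <;> simp

theorem continuous_polarPoint (x₀ : EuclideanSpace ℝ (Fin 2)) : Continuous (polarPoint x₀) := by
  have h : polarPoint x₀ = fun q =>
      x₀ + ((q.1 * cos q.2) • !₂[(1 : ℝ), 0] + (q.1 * sin q.2) • !₂[(0 : ℝ), 1]) := by
    ext r i
    fin_cases i <;> simp [polarPoint]
  rw [h]
  fun_prop

theorem map_vec2 (L : EuclideanSpace ℝ (Fin 2) →L[ℝ] ℂ) (a b : ℝ) :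
    L !₂[a, b] = a * L (EuclideanSpace.single 0 1) + b * L (EuclideanSpace.single 1 1) := by
  have : (!₂[a, b] : EuclideanSpace ℝ (Fin 2))
      = a • EuclideanSpace.single 0 1 + b • EuclideanSpace.single 1 1 := by
    ext i
    fin_cases i <;> simp
  rw [this, map_add, map_smul, map_smul, Complex.real_smul, Complex.real_smul]

theorem normSq_rotation (α β : ℂ) (θ : ℝ) :
    ‖α‖ ^ 2 + ‖β‖ ^ 2 = ‖cos θ * α + sin θ * β‖ ^ 2 + ‖-sin θ * α + cos θ * β‖ ^ 2 := by
  simp only [Complex.sq_norm, Complex.normSq_apply]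
  simp [-Complex.ofReal_cos, -Complex.ofReal_sin]
  linear_combination (-(α.re ^ 2 + α.im ^ 2 + β.re ^ 2 + β.im ^ 2)) * sin_sq_add_cos_sq θ

theorem magGradSq_polarPoint (x₀ : EuclideanSpace ℝ (Fin 2)) (ν : ℝ)
    (u : EuclideanSpace ℝ (Fin 2) → ℂ) {r : ℝ} (hr : 0 < r) (θ : ℝ) :
    r * magGradSq (AB x₀ ν) u (polarPoint x₀ (r, θ)) =
      r * ‖fderiv ℝ u (polarPoint x₀ (r, θ)) !₂[cos θ, sin θ]‖ ^ 2
        + ‖fderiv ℝ u (polarPoint x₀ (r, θ)) !₂[-(r * sin θ), r * cos θ]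
          - Complex.I * ν * u (polarPoint x₀ (r, θ))‖ ^ 2 / r := by
  have hn := norm_polarPoint_sub x₀ (q := (r, θ)) hr.le
  have h0 : polarPoint x₀ (r, θ) 0 - x₀ 0 = r * cos θ := by simp [polarPoint]
  have h1 : polarPoint x₀ (r, θ) 1 - x₀ 1 = r * sin θ := by simp [polarPoint]
  simp only [magGradSq, Fin.sum_univ_two, AB, hn, h0, h1, if_true, one_ne_zero, if_false]
  rw [map_vec2, map_vec2, normSq_rotation _ _ θ, mul_add]
  set a := fderiv ℝ u (polarPoint x₀ (r, θ)) (EuclideanSpace.single 0 1)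
  set b := fderiv ℝ u (polarPoint x₀ (r, θ)) (EuclideanSpace.single 1 1)
  set z := u (polarPoint x₀ (r, θ))
  have hrc : (r : ℂ) ≠ 0 := by exact_mod_cast hr.ne'
  have hcs : (sin θ : ℂ) ^ 2 + (cos θ : ℂ) ^ 2 = 1 := by exact_mod_cast sin_sq_add_cos_sq θ
  have e1 : (cos θ : ℂ) * (a - Complex.I * z * ((-ν * (r * sin θ) / r ^ 2 : ℝ) : ℂ))
      + sin θ * (b - Complex.I * z * ((ν * (r * cos θ) / r ^ 2 : ℝ) : ℂ))
      = cos θ * a + sin θ * b := by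
    push_cast
    field_simp
    ring
  have e2 : -(sin θ : ℂ) * (a - Complex.I * z * ((-ν * (r * sin θ) / r ^ 2 : ℝ) : ℂ))
      + cos θ * (b - Complex.I * z * ((ν * (r * cos θ) / r ^ 2 : ℝ) : ℂ))
      = ((r⁻¹ : ℝ) : ℂ) * (((-(r * sin θ) : ℝ) : ℂ) * a + ((r * cos θ : ℝ) : ℂ) * b
        - Complex.I * ν * z) := by
    push_cast [-Complex.ofReal_cos, -Complex.ofReal_sin]
    field_simp
    linear_combination (-Complex.I * z * ν) * hcs
  rw [e1, e2, norm_mul, mul_pow, Complex.norm_real, Real.norm_eq_abs, sq_abs]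
  congr 1
  field_simp

/-- The Poincaré-type lower bound for the magnetic energy on the disk centred at the pole. -/
theorem RadialProfile.le_magnetic_energy {d R Λ ν : ℝ} {f f₁ : ℝ → ℝ}
    (h : RadialProfile d R Λ f f₁) (hR : 0 < R) (hd : 0 ≤ d) (hν : ∀ m : ℤ, d ≤ |ν - m|)
    {x₀ : EuclideanSpace ℝ (Fin 2)} {u : EuclideanSpace ℝ (Fin 2) → ℂ} (hu : ContDiff ℝ ∞ u)
    (hu0 : VanishesNear x₀ u) :
    Λ * ∫ x in ball x₀ R, ‖u x‖ ^ 2 ≤ ∫ x in ball x₀ R, magGradSq (AB x₀ ν) u x := by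
  obtain ⟨ε, hε, hz⟩ := hu0
  obtain ⟨ρ, hρ0, hρ⟩ := exists_between (lt_min hε hR)
  have hρε : ρ < ε := hρ.trans_le (min_le_left _ _)
  have hρR : ρ < R := hρ.trans_le (min_le_right _ _)
  have hz' : ∀ x ∈ ball x₀ ε, fderiv ℝ u x = 0 := fun x hx => by
    have : u =ᶠ[nhds x] fun _ => 0 := by
      filter_upwards [isOpen_ball.mem_nhds hx] with y hy using hz y hy
    rw [this.fderiv_eq, fderiv_fun_const]; rfl
  set U : ℝ × ℝ → ℂ := fun q => u (polarPoint x₀ q) with hU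
  set Ur : ℝ × ℝ → ℂ := fun q => fderiv ℝ u (polarPoint x₀ q) !₂[cos q.2, sin q.2] with hUr
  set Uθ : ℝ × ℝ → ℂ := fun q =>
    fderiv ℝ u (polarPoint x₀ q) !₂[-(q.1 * sin q.2), q.1 * cos q.2] with hUθ
  have hdiff : Differentiable ℝ u := hu.differentiable (by simp)
  have hUc : Continuous U := hu.continuous.comp (continuous_polarPoint x₀)
  have hfc : Continuous fun q => fderiv ℝ u (polarPoint x₀ q) :=
    (hu.continuous_fderiv (by simp)).comp (continuous_polarPoint x₀)
  have hUrc : Continuous Ur := by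
    simp only [hUr, map_vec2]
    fun_prop
  have hUθc : Continuous Uθ := by
    simp only [hUθ, map_vec2]
    fun_prop
  have hUrd : ∀ r θ, HasDerivAt (fun r => U (r, θ)) (Ur (r, θ)) r := fun r θ =>
    (hdiff _).hasFDerivAt.comp_hasDerivAt r (hasDerivAt_polarPoint_fst x₀ r θ)
  have hUθd : ∀ r θ, HasDerivAt (fun θ => U (r, θ)) (Uθ (r, θ)) θ := fun r θ =>
    (hdiff _).hasFDerivAt.comp_hasDerivAt θ (hasDerivAt_polarPoint_snd x₀ r θ)
  set S := Ioo ρ R ×ˢ Ioo (-π) π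
  have hSm : MeasurableSet S := measurableSet_Ioo.prod measurableSet_Ioo
  have hint : ∀ g : ℝ × ℝ → ℝ, ContinuousOn g (Icc ρ R ×ˢ Icc (-π) π) →
      IntegrableOn g S := fun g hg =>
    (hg.integrableOn_compact (isCompact_Icc.prod isCompact_Icc)).mono_set
      (prod_mono Ioo_subset_Icc_self Ioo_subset_Icc_self)
  have hne : ∀ q ∈ Icc ρ R ×ˢ Icc (-π) π, q.1 ≠ 0 := fun q hq => (hρ0.trans_le hq.1.1).ne'
  have hinv : ContinuousOn (fun q : ℝ × ℝ => d ^ 2 / q.1) (Icc ρ R ×ˢ Icc (-π) π) :=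
    continuousOn_const.div continuousOn_fst hne
  have hW : ContinuousOn (fun q : ℝ × ℝ => ‖Uθ q - Complex.I * ν * U q‖ ^ 2 / q.1)
      (Icc ρ R ×ˢ Icc (-π) π) :=
    ContinuousOn.div (by fun_prop) continuousOn_fst hne
  set E₁ : ℝ × ℝ → ℝ := fun q =>
    q.1 * ‖Ur q‖ ^ 2 + d ^ 2 / q.1 * ‖U q‖ ^ 2 - Λ * (q.1 * ‖U q‖ ^ 2) with hE₁
  set E₂ : ℝ × ℝ → ℝ := fun q =>
    ‖Uθ q - Complex.I * ν * U q‖ ^ 2 / q.1 - d ^ 2 / q.1 * ‖U q‖ ^ 2 with hE₂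
  have hE₁i : IntegrableOn E₁ S := hint _ (by fun_prop)
  have hE₂i : IntegrableOn E₂ S := hint _ (hW.sub (by fun_prop))
  have hMi : IntegrableOn (fun q => q.1 * ‖U q‖ ^ 2) S := hint _ (by fun_prop)
  rw [setIntegral_ball_eq_polar x₀ (Φ := fun x => ‖u x‖ ^ 2)
      (fun x hx => by simp [hz x hx]) hρ0 hρε,
    setIntegral_ball_eq_polar x₀ (Φ := fun x => magGradSq (AB x₀ ν) u x)
      (fun x hx => by simp [magGradSq, hz x hx, hz' x hx]) hρ0 hρε]
  have hE : IntegrableOn (fun q => E₁ q + E₂ q) S := hE₁i.add hE₂i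
  have hsplit : ∫ q in S, q.1 * magGradSq (AB x₀ ν) u (polarPoint x₀ q)
      = Λ * (∫ q in S, q.1 * ‖U q‖ ^ 2) + ((∫ q in S, E₁ q) + ∫ q in S, E₂ q) := by
    rw [← integral_const_mul, ← integral_add hE₁i hE₂i,
      ← integral_add (hMi.const_mul Λ) hE]
    refine setIntegral_congr_fun hSm fun q hq => ?_
    have := magGradSq_polarPoint x₀ ν u (hρ0.trans hq.1.1) q.2
    simp only [Prod.mk.eta] at this
    simp only [this, hE₁, hE₂, hU, hUr, hUθ]
    ring
  have hpos₁ : 0 ≤ ∫ q in S, E₁ q := by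
    rw [IntegrableOn, Measure.volume_eq_prod, ← Measure.prod_restrict] at hE₁i
    rw [Measure.volume_eq_prod, ← Measure.prod_restrict, integral_prod_symm _ hE₁i]
    refine integral_nonneg fun θ => ?_
    simp only [Pi.zero_apply]
    rw [← integral_Ioc_eq_integral_Ioo, ← intervalIntegral.integral_of_le hρR.le]
    refine h.picone hρ0 hρR.le (fun r => hUrd r θ) (by fun_prop) (hz _ ?_)
    rw [mem_ball, dist_eq_norm, norm_polarPoint_sub x₀ hρ0.le]
    exact hρε
  have hpos₂ : 0 ≤ ∫ q in S, E₂ q := by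
    rw [Measure.volume_eq_prod]
    rw [setIntegral_prod _ (by rwa [← Measure.volume_eq_prod])]
    refine setIntegral_nonneg measurableSet_Ioo fun r hr => ?_
    have hr0 : 0 < r := hρ0.trans hr.1
    have hpi : -π ≤ π := by linarith [pi_pos]
    rw [← integral_Ioc_eq_integral_Ioo, ← intervalIntegral.integral_of_le hpi]
    have hw := magnetic_wirtinger hd hν (hUθd r) (by fun_prop) (by simp [hU, polarPoint])
    have : ∫ θ in -π..π, E₂ (r, θ) = r⁻¹ * ((∫ θ in -π..π,
        ‖Uθ (r, θ) - Complex.I * ν * U (r, θ)‖ ^ 2) - d ^ 2 * ∫ θ in -π..π, ‖U (r, θ)‖ ^ 2) := by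
      rw [← intervalIntegral.integral_const_mul, ← intervalIntegral.integral_sub,
        ← intervalIntegral.integral_const_mul]
      · refine intervalIntegral.integral_congr fun θ _ => ?_
        simp only [hE₂]
        ring
      · exact Continuous.intervalIntegrable (by fun_prop) _ _
      · exact Continuous.intervalIntegrable (by fun_prop) _ _
    rw [this]
    exact mul_nonneg (by positivity) (by linarith)
  rw [hsplit]
  linarith

end LowerBound

section Trial

open Set Real Metric Filter Topology
open scoped ContDiff

theorem lambda1_mul_le {x₀ : EuclideanSpace ℝ (Fin 2)} {ν : ℝ}
    {D : Set (EuclideanSpace ℝ (Fin 2))} {u : EuclideanSpace ℝ (Fin 2) → ℂ} (hu : ContDiff ℝ ∞ u)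
    (hu0 : VanishesNear x₀ u) :
    lambda1 x₀ ν D * ∫ x in D, ‖u x‖ ^ 2 ≤ ∫ x in D, magGradSq (AB x₀ ν) u x := by
  have hnn : ∀ v : EuclideanSpace ℝ (Fin 2) → ℂ, 0 ≤ ∫ x in D, magGradSq (AB x₀ ν) v x :=
    fun v => integral_nonneg fun x => Finset.sum_nonneg fun i _ => sq_nonneg _
  have h0 : 0 ≤ ∫ x in D, ‖u x‖ ^ 2 := integral_nonneg fun x => sq_nonneg _
  rcases h0.eq_or_lt with h | h
  · rw [← h, mul_zero]; exact hnn u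
  · rw [← le_div_iff₀ h]
    refine csInf_le ⟨0, ?_⟩ ⟨u, hu, hu0, h, rfl⟩
    rintro q ⟨v, -, -, hv, rfl⟩
    exact div_nonneg (hnn v) hv.le

/-- The function with modulus `φ` and angular dependence `e^{ikθ}` in polar coordinates. -/
noncomputable def angularMode (x₀ : EuclideanSpace ℝ (Fin 2)) (k : ℤ) (φ : ℝ → ℝ)
    (x : EuclideanSpace ℝ (Fin 2)) : ℂ :=
  φ ‖x - x₀‖ * ((((x 0 - x₀ 0 : ℝ) : ℂ) + ((x 1 - x₀ 1 : ℝ) : ℂ) * Complex.I) / ‖x - x₀‖) ^ k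

theorem angularMode_polarPoint (x₀ : EuclideanSpace ℝ (Fin 2)) (k : ℤ) (φ : ℝ → ℝ) {r : ℝ}
    (hr : 0 < r) (θ : ℝ) :
    angularMode x₀ k φ (polarPoint x₀ (r, θ)) = φ r * Complex.exp (k * (θ * Complex.I)) := by
  have hn := norm_polarPoint_sub x₀ (q := (r, θ)) hr.le
  have h0 : polarPoint x₀ (r, θ) 0 - x₀ 0 = r * cos θ := by simp [polarPoint]
  have h1 : polarPoint x₀ (r, θ) 1 - x₀ 1 = r * sin θ := by simp [polarPoint]
  have hrc : (r : ℂ) ≠ 0 := by exact_mod_cast hr.ne'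
  rw [angularMode, hn, h0, h1, Complex.exp_int_mul, Complex.exp_mul_I]
  congr 2
  push_cast
  field_simp

theorem exists_eq_polarPoint (x₀ x : EuclideanSpace ℝ (Fin 2)) :
    ∃ θ, x = polarPoint x₀ (‖x - x₀‖, θ) := by
  set z : ℂ := ⟨x 0 - x₀ 0, x 1 - x₀ 1⟩ with hz
  have hn : ‖x - x₀‖ = ‖z‖ := by
    rw [EuclideanSpace.norm_eq, Fin.sum_univ_two, Complex.norm_def, Complex.normSq_apply]
    simp [hz, sq]
  refine ⟨z.arg, ?_⟩
  ext i
  fin_cases i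
  · simp [polarPoint, hn, Complex.norm_mul_cos_arg, hz]
  · simp [polarPoint, hn, Complex.norm_mul_sin_arg, hz]

theorem contDiffAt_zpow_of_ne {z : ℂ} (hz : z ≠ 0) (k : ℤ) :
    ContDiffAt ℝ ∞ (fun w : ℂ => w ^ k) z := by
  cases k with
  | ofNat n => simpa using (contDiff_id.pow n).contDiffAt
  | negSucc n =>
    simp only [zpow_negSucc]
    exact ((contDiff_id.pow (n + 1)).contDiffAt).inv (pow_ne_zero _ hz)

theorem contDiffAt_angularMode {x₀ x : EuclideanSpace ℝ (Fin 2)} (hx : x ≠ x₀) (k : ℤ)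
    {φ : ℝ → ℝ} (hφ : ContDiffOn ℝ ∞ φ (Ioi 0)) : ContDiffAt ℝ ∞ (angularMode x₀ k φ) x := by
  have hr : 0 < ‖x - x₀‖ := norm_pos_iff.2 (sub_ne_zero.2 hx)
  have hn : ContDiffAt ℝ ∞ (fun x => ‖x - x₀‖) x :=
    (contDiffAt_id.sub contDiffAt_const).norm ℝ (sub_ne_zero.2 hx)
  have hof : ∀ {g : EuclideanSpace ℝ (Fin 2) → ℝ}, ContDiffAt ℝ ∞ g x →
      ContDiffAt ℝ ∞ (fun x => (g x : ℂ)) x := fun hg =>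
    Complex.ofRealCLM.contDiff.contDiffAt.comp x hg
  have hφn : ContDiffAt ℝ ∞ (fun x => φ ‖x - x₀‖) x :=
    ContDiffAt.comp x (hφ.contDiffAt (Ioi_mem_nhds hr)) hn
  have h0 : ContDiffAt ℝ ∞ (fun x : EuclideanSpace ℝ (Fin 2) => x 0 - x₀ 0) x := by fun_prop
  have h1 : ContDiffAt ℝ ∞ (fun x : EuclideanSpace ℝ (Fin 2) => x 1 - x₀ 1) x := by fun_prop
  have hrc : ((‖x - x₀‖ : ℝ) : ℂ) ≠ 0 := by exact_mod_cast hr.ne'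
  have hb := ((hof h0).add ((hof h1).mul (contDiffAt_const (c := Complex.I)))).mul
    ((hof hn).inv hrc)
  refine (hof hφn).mul ?_
  simp only [div_eq_mul_inv]
  refine ContDiffAt.comp x (contDiffAt_zpow_of_ne ?_ k) hb
  obtain ⟨θ, hθ⟩ := exists_eq_polarPoint x₀ x
  refine mul_ne_zero ?_ (inv_ne_zero hrc)
  intro hcon
  have hre := congrArg Complex.re hcon
  have him := congrArg Complex.im hcon
  simp at hre him
  refine hr.ne' ?_
  rw [EuclideanSpace.norm_eq, Fin.sum_univ_two]
  simp [hre, him]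

theorem magGradSq_angularMode {x₀ x : EuclideanSpace ℝ (Fin 2)} (hx : x ≠ x₀) (ν : ℝ) (k : ℤ)
    {φ : ℝ → ℝ} (hφ : ContDiffOn ℝ ∞ φ (Ioi 0)) {φ' : ℝ} (hφ' : HasDerivAt φ φ' ‖x - x₀‖) :
    magGradSq (AB x₀ ν) (angularMode x₀ k φ) x
      = φ' ^ 2 + (ν - k) ^ 2 * φ ‖x - x₀‖ ^ 2 / ‖x - x₀‖ ^ 2 := by
  obtain ⟨θ, hθ⟩ := exists_eq_polarPoint x₀ x
  have hr : 0 < ‖x - x₀‖ := norm_pos_iff.2 (sub_ne_zero.2 hx)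
  have hdiff := (contDiffAt_angularMode hx k hφ).differentiableAt (by simp)
  set r := ‖x - x₀‖
  have key := magGradSq_polarPoint x₀ ν (angularMode x₀ k φ) hr θ
  have hexp : ‖Complex.exp (k * (θ * Complex.I))‖ = 1 := by
    rw [← mul_assoc]; exact_mod_cast Complex.norm_exp_ofReal_mul_I (k * θ)
  have e1 : fderiv ℝ (angularMode x₀ k φ) x !₂[cos θ, sin θ]
      = φ' * Complex.exp (k * (θ * Complex.I)) := by
    have h1 : HasDerivAt (fun s => angularMode x₀ k φ (polarPoint x₀ (s, θ)))
        (fderiv ℝ (angularMode x₀ k φ) x !₂[cos θ, sin θ]) r := by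
      rw [hθ] at hdiff ⊢
      exact hdiff.hasFDerivAt.comp_hasDerivAt r (hasDerivAt_polarPoint_fst x₀ r θ)
    refine h1.unique (((hφ'.ofReal_comp).mul_const
      (Complex.exp (k * (θ * Complex.I)))).congr_of_eventuallyEq ?_)
    filter_upwards [Ioi_mem_nhds hr] with s hs using angularMode_polarPoint x₀ k φ hs θ
  have e2 : fderiv ℝ (angularMode x₀ k φ) x !₂[-(r * sin θ), r * cos θ]
      = φ r * (k * Complex.I * Complex.exp (k * (θ * Complex.I))) := by
    have h1 : HasDerivAt (fun s => angularMode x₀ k φ (polarPoint x₀ (r, s)))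
        (fderiv ℝ (angularMode x₀ k φ) x !₂[-(r * sin θ), r * cos θ]) θ := by
      rw [hθ] at hdiff ⊢
      exact hdiff.hasFDerivAt.comp_hasDerivAt θ (hasDerivAt_polarPoint_snd x₀ r θ)
    rw [funext fun s => angularMode_polarPoint x₀ k φ hr s] at h1
    have h2 : HasDerivAt (fun s : ℝ => (k : ℂ) * (s * Complex.I)) (k * (1 * Complex.I)) θ := by
      simpa using ((hasDerivAt_id θ).ofReal_comp.mul_const Complex.I).const_mul (k : ℂ)
    refine h1.unique ((h2.cexp.const_mul (φ r : ℂ)).congr_deriv ?_)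
    ring
  rw [← hθ, e1, e2] at key
  have e3 : angularMode x₀ k φ x = φ r * Complex.exp (k * (θ * Complex.I)) := by
    conv_lhs => rw [hθ]
    exact angularMode_polarPoint x₀ k φ hr θ
  have e4 : φ r * (k * Complex.I * Complex.exp (k * (θ * Complex.I)))
      - Complex.I * ν * (φ r * Complex.exp (k * (θ * Complex.I)))
      = Complex.I * ((φ r * (k - ν) : ℝ) : ℂ) * Complex.exp (k * (θ * Complex.I)) := by
    push_cast; ring
  rw [e3, e4, norm_mul, norm_mul, norm_mul, hexp, Complex.norm_I, Complex.norm_real,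
    Complex.norm_real, one_mul, mul_one, mul_one, Real.norm_eq_abs, Real.norm_eq_abs, sq_abs,
    sq_abs] at key
  have : r * magGradSq (AB x₀ ν) (angularMode x₀ k φ) x
      = r * (φ' ^ 2 + (ν - k) ^ 2 * φ r ^ 2 / r ^ 2) := by
    rw [key]
    field_simp
    ring
  exact mul_left_cancel₀ hr.ne' this

theorem norm_angularMode {x₀ x : EuclideanSpace ℝ (Fin 2)} (hx : x ≠ x₀) (k : ℤ) (φ : ℝ → ℝ) :
    ‖angularMode x₀ k φ x‖ ^ 2 = φ ‖x - x₀‖ ^ 2 := by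
  obtain ⟨θ, hθ⟩ := exists_eq_polarPoint x₀ x
  have hr : 0 < ‖x - x₀‖ := norm_pos_iff.2 (sub_ne_zero.2 hx)
  have hexp : ‖Complex.exp (k * (θ * Complex.I))‖ = 1 := by
    rw [← mul_assoc]; exact_mod_cast Complex.norm_exp_ofReal_mul_I (k * θ)
  conv_lhs => rw [hθ]
  rw [angularMode_polarPoint x₀ k φ hr θ, norm_mul, hexp, Complex.norm_real, mul_one,
    Real.norm_eq_abs, sq_abs]

/-- The radial function `φ`, with derivative `φ'`, obeys the variational bound for
`lambda1 x₀ ν D` when used with angular frequency at distance `|δ|` from `ν`. -/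
def TrialBound (x₀ : EuclideanSpace ℝ (Fin 2)) (ν δ : ℝ) (D : Set (EuclideanSpace ℝ (Fin 2)))
    (φ φ' : ℝ → ℝ) : Prop :=
  lambda1 x₀ ν D * ∫ x in D, φ ‖x - x₀‖ ^ 2 ≤
    ∫ x in D, (φ' ‖x - x₀‖ ^ 2 + δ ^ 2 * φ ‖x - x₀‖ ^ 2 / ‖x - x₀‖ ^ 2)

theorem ae_ne_pole (x₀ : EuclideanSpace ℝ (Fin 2)) (D : Set (EuclideanSpace ℝ (Fin 2))) :
    ∀ᵐ x ∂(volume.restrict D), x ≠ x₀ :=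
  ae_restrict_of_ae (Measure.ae_ne volume x₀)

theorem trialBound_of_contDiffOn (x₀ : EuclideanSpace ℝ (Fin 2)) (ν : ℝ) (k : ℤ)
    (D : Set (EuclideanSpace ℝ (Fin 2))) {φ φ' : ℝ → ℝ} (hφ : ContDiffOn ℝ ∞ φ (Ioi 0))
    (hφ' : ∀ r, 0 < r → HasDerivAt φ (φ' r) r) {ε : ℝ} (hε : 0 < ε)
    (h0 : ∀ r < ε, φ r = 0) : TrialBound x₀ ν (ν - k) D φ φ' := by
  have hv : ∀ x ∈ ball x₀ ε, angularMode x₀ k φ x = 0 := fun x hx => by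
    rw [mem_ball, dist_eq_norm] at hx
    simp [angularMode, h0 _ hx]
  have hsm : ContDiff ℝ ∞ (angularMode x₀ k φ) := by
    refine contDiff_iff_contDiffAt.2 fun x => ?_
    rcases eq_or_ne x x₀ with rfl | hx
    · have hc : ContDiffAt ℝ ∞ (fun _ : EuclideanSpace ℝ (Fin 2) => (0 : ℂ)) x :=
        contDiffAt_const
      refine hc.congr_of_eventuallyEq ?_
      filter_upwards [ball_mem_nhds x hε] with y hy using hv y hy
    · exact contDiffAt_angularMode hx k hφ
  have key := lambda1_mul_le (ν := ν) (D := D) hsm ⟨ε, hε, hv⟩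
  have e1 : ∫ x in D, φ ‖x - x₀‖ ^ 2 = ∫ x in D, ‖angularMode x₀ k φ x‖ ^ 2 := by
    refine integral_congr_ae ?_
    filter_upwards [ae_ne_pole x₀ D] with x hx using (norm_angularMode hx k φ).symm
  have e2 : ∫ x in D, (φ' ‖x - x₀‖ ^ 2 + (ν - k) ^ 2 * φ ‖x - x₀‖ ^ 2 / ‖x - x₀‖ ^ 2)
      = ∫ x in D, magGradSq (AB x₀ ν) (angularMode x₀ k φ) x := by
    refine integral_congr_ae ?_
    filter_upwards [ae_ne_pole x₀ D] with x hx
    exact (magGradSq_angularMode hx ν k hφ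
      (hφ' _ (norm_pos_iff.2 (sub_ne_zero.2 hx)))).symm
  rwa [TrialBound, e1, e2]

end Trial

section Limits

open Set Real Metric Filter Topology
open scoped ContDiff

theorem aestronglyMeasurable_comp_norm_sub {ψ : ℝ → ℝ} (hψ : ContinuousOn ψ (Ioi 0))
    (x₀ : EuclideanSpace ℝ (Fin 2)) (D : Set (EuclideanSpace ℝ (Fin 2))) :
    AEStronglyMeasurable (fun x => ψ ‖x - x₀‖) (volume.restrict D) := by
  have hc : ContinuousOn (fun x => ψ ‖x - x₀‖) ({x₀}ᶜ : Set (EuclideanSpace ℝ (Fin 2))) :=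
    hψ.comp (by fun_prop) fun x hx => norm_pos_iff.2 (sub_ne_zero.2 hx)
  have h := hc.aestronglyMeasurable (μ := volume) (measurableSet_singleton x₀).compl
  rw [restrict_compl_singleton] at h
  exact h.restrict

theorem integrableOn_norm_sub_rpow {a : ℝ} (ha : -2 < a) (x₀ p : EuclideanSpace ℝ (Fin 2))
    (R : ℝ) : IntegrableOn (fun x => ‖x - x₀‖ ^ a) (ball p R) := by
  have h0 : IntegrableOn (fun x : EuclideanSpace ℝ (Fin 2) => ‖x‖ ^ a)
      (ball 0 (R + dist p x₀)) := by
    have hm := aestronglyMeasurable_comp_norm_sub (ψ := fun r => r ^ a)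
      (fun r hr => (continuousAt_rpow_const r a (Or.inl (ne_of_gt hr))).continuousWithinAt)
      0 univ
    simp only [sub_zero, Measure.restrict_univ] at hm
    refine integrableOn_ball_of_norm_le_rpow (C := 1) (α := -a) (by simp) (by simp; linarith)
      (Eventually.of_forall fun x => ?_) hm
    rw [neg_neg, one_mul, norm_of_nonneg (by positivity)]
  rw [← integrable_indicator_iff measurableSet_ball] at h0
  have h1 := h0.comp_sub_right x₀
  have h2 : IntegrableOn (fun x => ‖x - x₀‖ ^ a) (ball x₀ (R + dist p x₀)) := by
    rw [← integrable_indicator_iff measurableSet_ball]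
    refine h1.congr (Eventually.of_forall fun x => ?_)
    simp [indicator, dist_eq_norm]
  exact h2.mono_set (ball_subset_ball' le_rfl)

theorem trialBound_of_tendsto {x₀ p : EuclideanSpace ℝ (Fin 2)} {ν δ R d C : ℝ} (hd : 0 < d)
    {G G' : ℕ → ℝ → ℝ} {F F' : ℝ → ℝ} (hG : ∀ n, ContinuousOn (G n) (Ioi 0))
    (hG' : ∀ n, ContinuousOn (G' n) (Ioi 0)) (hb : ∀ n r, 0 < r → |G n r| ≤ C * r ^ d)
    (hb' : ∀ n r, 0 < r → |G' n r| ≤ C * r ^ (d - 1))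
    (hlim : ∀ r, 0 < r → Tendsto (fun n => G n r) atTop (𝓝 (F r)))
    (hlim' : ∀ r, 0 < r → Tendsto (fun n => G' n r) atTop (𝓝 (F' r)))
    (h : ∀ n, TrialBound x₀ ν δ (ball p R) (G n) (G' n)) :
    TrialBound x₀ ν δ (ball p R) F F' := by
  have hsq : ∀ {y c : ℝ}, |y| ≤ c → y ^ 2 ≤ c ^ 2 := fun {y c} hy => by
    rw [← sq_abs y]; exact pow_le_pow_left₀ (abs_nonneg y) hy 2
  have hp1 : ∀ r : ℝ, 0 < r → (C * r ^ d) ^ 2 = C ^ 2 * r ^ (2 * d) := fun r hr => by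
    rw [mul_pow, ← rpow_mul_natCast hr.le, mul_comm d]; norm_num
  have hp2 : ∀ r : ℝ, 0 < r → (C * r ^ (d - 1)) ^ 2 = C ^ 2 * r ^ (2 * d - 2) := fun r hr => by
    rw [mul_pow, ← rpow_mul_natCast hr.le]; congr 2; push_cast; ring
  have hp3 : ∀ r : ℝ, 0 < r → C ^ 2 * r ^ (2 * d) / r ^ 2 = C ^ 2 * r ^ (2 * d - 2) :=
    fun r hr => by
      rw [rpow_sub hr, mul_div_assoc]; norm_num
  have hr0 : ∀ x : EuclideanSpace ℝ (Fin 2), x ≠ x₀ → 0 < ‖x - x₀‖ := fun x hx =>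
    norm_pos_iff.2 (sub_ne_zero.2 hx)
  have T1 : Tendsto (fun n => ∫ x in ball p R, G n ‖x - x₀‖ ^ 2) atTop
      (𝓝 (∫ x in ball p R, F ‖x - x₀‖ ^ 2)) := by
    refine tendsto_integral_of_dominated_convergence (fun x => C ^ 2 * ‖x - x₀‖ ^ (2 * d))
      (fun n => aestronglyMeasurable_comp_norm_sub (ψ := fun r => G n r ^ 2) ((hG n).pow 2) _ _)
      ((integrableOn_norm_sub_rpow (by linarith) x₀ p R).const_mul _) (fun n => ?_) ?_
    · filter_upwards [ae_ne_pole x₀ (ball p R)] with x hx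
      rw [norm_of_nonneg (sq_nonneg _), ← hp1 _ (hr0 x hx)]
      exact hsq (hb n _ (hr0 x hx))
    · filter_upwards [ae_ne_pole x₀ (ball p R)] with x hx
      exact (hlim _ (hr0 x hx)).pow 2
  have T2 : Tendsto (fun n => ∫ x in ball p R,
        (G' n ‖x - x₀‖ ^ 2 + δ ^ 2 * G n ‖x - x₀‖ ^ 2 / ‖x - x₀‖ ^ 2)) atTop
      (𝓝 (∫ x in ball p R, (F' ‖x - x₀‖ ^ 2 + δ ^ 2 * F ‖x - x₀‖ ^ 2 / ‖x - x₀‖ ^ 2))) := by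
    refine tendsto_integral_of_dominated_convergence
      (fun x => (1 + δ ^ 2) * C ^ 2 * ‖x - x₀‖ ^ (2 * d - 2))
      (fun n => aestronglyMeasurable_comp_norm_sub
        (ψ := fun r => G' n r ^ 2 + δ ^ 2 * G n r ^ 2 / r ^ 2) (((hG' n).pow 2).add
          ((((hG n).pow 2).const_mul _).div (continuousOn_id.pow 2)
            fun r hr => pow_ne_zero 2 (ne_of_gt hr))) _ _)
      ((integrableOn_norm_sub_rpow (by linarith) x₀ p R).const_mul _) (fun n => ?_) ?_
    · filter_upwards [ae_ne_pole x₀ (ball p R)] with x hx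
      have hr := hr0 x hx
      have h1 := hsq (hb n _ hr)
      have h2 := hsq (hb' n _ hr)
      rw [hp1 _ hr] at h1
      rw [hp2 _ hr] at h2
      have h3 : G n ‖x - x₀‖ ^ 2 / ‖x - x₀‖ ^ 2 ≤ C ^ 2 * ‖x - x₀‖ ^ (2 * d - 2) := by
        rw [← hp3 _ hr]; gcongr
      rw [norm_of_nonneg (by positivity), mul_div_assoc]
      have := mul_le_mul_of_nonneg_left h3 (sq_nonneg δ)
      nlinarith
    · filter_upwards [ae_ne_pole x₀ (ball p R)] with x hx
      exact ((hlim' _ (hr0 x hx)).pow 2).add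
        ((((hlim _ (hr0 x hx)).pow 2).const_mul _).div_const _)
  exact le_of_tendsto_of_tendsto' (T1.const_mul _) T2 h

end Limits

section Cutoff

open Set Real Metric Filter Topology
open scoped ContDiff

theorem deriv_smoothTransition_eq_zero {t : ℝ} (ht : t ≤ 0 ∨ 1 ≤ t) :
    deriv smoothTransition t = 0 := by
  rcases ht with ht | ht
  · refine IsLocalMin.deriv_eq_zero (Eventually.of_forall fun s => ?_)
    rw [smoothTransition.zero_of_nonpos ht]
    exact smoothTransition.nonneg s
  · refine IsLocalMax.deriv_eq_zero (Eventually.of_forall fun s => ?_)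
    rw [smoothTransition.one_of_one_le ht]
    exact smoothTransition.le_one s

theorem exists_abs_deriv_smoothTransition_le :
    ∃ M, 0 ≤ M ∧ ∀ t, |deriv smoothTransition t| ≤ M := by
  have hc : Continuous (deriv smoothTransition) :=
    (smoothTransition.contDiff (n := 1)).continuous_deriv le_rfl
  obtain ⟨M, hM⟩ := (isCompact_Icc (a := (0 : ℝ)) (b := 1)).exists_bound_of_continuousOn
    hc.continuousOn
  refine ⟨M, (norm_nonneg _).trans (hM 0 (by simp)), fun t => ?_⟩
  by_cases ht : t ∈ Icc (0 : ℝ) 1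
  · exact hM t ht
  · rw [deriv_smoothTransition_eq_zero, abs_zero]
    · exact (norm_nonneg _).trans (hM 0 (by simp))
    · by_contra! hcon
      exact ht ⟨hcon.1.le, hcon.2.le⟩

theorem hasDerivAt_smoothTransition (t : ℝ) :
    HasDerivAt smoothTransition (deriv smoothTransition t) t :=
  ((smoothTransition.contDiff (n := 1)).differentiable (by simp) t).hasDerivAt

theorem continuousOn_of_contDiffOn_of_hasDerivAt {φ φ' : ℝ → ℝ} (hφ : ContDiffOn ℝ ∞ φ (Ioi 0))
    (hφ' : ∀ r, 0 < r → HasDerivAt φ (φ' r) r) : ContinuousOn φ' (Ioi 0) :=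
  (hφ.continuousOn_deriv_of_isOpen isOpen_Ioi (by simp)).congr fun r hr => (hφ' r hr).deriv.symm

theorem trialBound_of_bound {x₀ p : EuclideanSpace ℝ (Fin 2)} {ν : ℝ} {k : ℤ} {R d C : ℝ}
    (hd : 0 < d) {F F' : ℝ → ℝ} (hF : ContDiffOn ℝ ∞ F (Ioi 0))
    (hF' : ∀ r, 0 < r → HasDerivAt F (F' r) r) (hC : 0 ≤ C) (hb : ∀ r, 0 < r → |F r| ≤ C * r ^ d)
    (hb' : ∀ r, 0 < r → |F' r| ≤ C * r ^ (d - 1)) :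
    TrialBound x₀ ν (ν - k) (ball p R) F F' := by
  obtain ⟨M, hM0, hM⟩ := exists_abs_deriv_smoothTransition_le
  set η := smoothTransition with hη
  have hη0 := smoothTransition.nonneg
  have hη1 := smoothTransition.le_one
  set G : ℕ → ℝ → ℝ := fun n r => η ((n + 1) * r - 1) * F r with hG
  set G' : ℕ → ℝ → ℝ := fun n r =>
    (deriv η ((n + 1) * r - 1) * (n + 1)) * F r + η ((n + 1) * r - 1) * F' r with hG'
  have hsm : ∀ n, ContDiffOn ℝ ∞ (G n) (Ioi 0) := fun n => by
    refine ContDiffOn.mul ?_ hF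
    refine (ContDiff.comp (g := η) smoothTransition.contDiff
      (f := fun r : ℝ => ((n : ℝ) + 1) * r - 1) ?_).contDiffOn
    fun_prop
  have hder : ∀ n r, 0 < r → HasDerivAt (G n) (G' n r) r := fun n r hr => by
    refine HasDerivAt.mul ?_ (hF' r hr)
    have h1 : HasDerivAt (fun r : ℝ => ((n : ℝ) + 1) * r - 1) (n + 1) r := by
      simpa using ((hasDerivAt_id r).const_mul ((n : ℝ) + 1)).sub_const 1
    exact (hasDerivAt_smoothTransition _).comp r h1
  refine trialBound_of_tendsto (C := (2 * M + 1) * C) hd (G := G) (G' := G')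
    (fun n => (hsm n).continuousOn)
    (fun n => continuousOn_of_contDiffOn_of_hasDerivAt (hsm n) (hder n)) ?_ ?_ ?_ ?_ ?_
  · intro n r hr
    rw [hG, abs_mul, abs_of_nonneg (hη0 _)]
    have h1 := mul_le_mul (hη1 ((n + 1) * r - 1)) (hb r hr) (abs_nonneg _) zero_le_one
    have h2 : 0 ≤ M * (C * r ^ d) := by positivity
    nlinarith
  · intro n r hr
    have hnp : (0 : ℝ) < n + 1 := by positivity
    have h1 : |η ((n + 1) * r - 1) * F' r| ≤ C * r ^ (d - 1) := by
      rw [abs_mul, abs_of_nonneg (hη0 _)]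
      simpa using mul_le_mul (hη1 ((n + 1) * r - 1)) (hb' r hr) (abs_nonneg _) zero_le_one
    have h2 : |deriv η ((n + 1) * r - 1) * (n + 1) * F r| ≤ 2 * M * (C * r ^ (d - 1)) := by
      by_cases hs : (n + 1) * r - 1 ≤ 0 ∨ 1 ≤ (n + 1) * r - 1
      · rw [hη, deriv_smoothTransition_eq_zero hs]
        simp only [zero_mul, abs_zero]
        positivity
      · push Not at hs
        have h3 : ((n : ℝ) + 1) ≤ 2 / r := by
          rw [le_div_iff₀ hr]; linarith [hs.2]
        rw [abs_mul, abs_mul, abs_of_pos hnp]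
        calc _ ≤ M * (2 / r) * (C * r ^ d) := by
              gcongr
              · exact hM _
              · exact hb r hr
          _ = _ := by rw [rpow_sub_one hr.ne']; ring
    refine (abs_add_le _ _).trans ?_
    linarith
  · intro r hr
    have hev : ∀ᶠ n : ℕ in atTop, G n r = F r := by
      filter_upwards [eventually_ge_atTop ⌈2 / r⌉₊] with n hn
      have h1 : 2 / r ≤ n := (Nat.le_ceil _).trans (by exact_mod_cast hn)
      rw [div_le_iff₀ hr] at h1
      have h2 : 1 ≤ ((n : ℝ) + 1) * r - 1 := by linarith
      simp [hG, hη, smoothTransition.one_of_one_le h2]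
    exact tendsto_const_nhds.congr' (hev.mono fun n h => h.symm)
  · intro r hr
    have hev : ∀ᶠ n : ℕ in atTop, G' n r = F' r := by
      filter_upwards [eventually_ge_atTop ⌈2 / r⌉₊] with n hn
      have h1 : 2 / r ≤ n := (Nat.le_ceil _).trans (by exact_mod_cast hn)
      rw [div_le_iff₀ hr] at h1
      have h2 : 1 ≤ ((n : ℝ) + 1) * r - 1 := by linarith
      simp [hG', hη, smoothTransition.one_of_one_le h2, deriv_smoothTransition_eq_zero (Or.inr h2)]
    exact tendsto_const_nhds.congr' (hev.mono fun n h => h.symm)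
  · intro n
    refine trialBound_of_contDiffOn x₀ ν k _ (hsm n) (hder n) (ε := 1 / (n + 1)) (by positivity)
      fun r hr => ?_
    rw [lt_div_iff₀ (by positivity)] at hr
    rw [hG]
    simp only
    rw [hη, smoothTransition.zero_of_nonpos (by linarith), zero_mul]

theorem RadialProfile.sub_le {d R Λ C : ℝ} {f f₁ : ℝ → ℝ} (h : RadialProfile d R Λ f f₁)
    (hd1 : d ≤ 1) (hC : 0 ≤ C) (hb : ∀ r, 0 < r → r ≤ R → f₁ r ≤ C * r ^ (d - 1)) {r : ℝ}
    (hr : 0 < r) (hrR : r ≤ R) : 0 ≤ f R - f r ∧ f R - f r ≤ C * r ^ (d - 1) * (R - r) := by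
  have hder : ∀ s ∈ Icc r R, HasDerivAt f (f₁ s) s := fun s hs => h.hasDerivAt s (hr.trans_le hs.1)
  have hcont : ContinuousOn f (Icc r R) := fun s hs => (hder s hs).continuousAt.continuousWithinAt
  have hdiff : DifferentiableOn ℝ f (interior (Icc r R)) := fun s hs =>
    (hder s (interior_subset hs)).differentiableAt.differentiableWithinAt
  have hl : r ∈ Icc r R := left_mem_Icc.2 hrR
  have hrt : R ∈ Icc r R := right_mem_Icc.2 hrR
  constructor
  · simpa using (convex_Icc r R).mul_sub_le_image_sub_of_le_deriv hcont hdiff (C := 0)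
      (fun s hs => by
        have hs' := interior_subset hs
        rw [(hder s hs').deriv]
        exact h.nonneg₁ s (hr.trans_le hs'.1) hs'.2) r hl R hrt hrR
  · refine (convex_Icc r R).image_sub_le_mul_sub_of_deriv_le hcont hdiff
      (fun s hs => ?_) r hl R hrt hrR
    have hs' := interior_subset hs
    rw [(hder s hs').deriv]
    refine (hb s (hr.trans_le hs'.1) hs'.2).trans (mul_le_mul_of_nonneg_left ?_ hC)
    exact rpow_le_rpow_of_nonpos hr hs'.1 (by linarith)

theorem RadialProfile.trialBound {d R Λ : ℝ} {f f₁ : ℝ → ℝ} (h : RadialProfile d R Λ f f₁)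
    (hd : 0 < d) (hd1 : d ≤ 1) (hR : 0 < R) (x₀ p : EuclideanSpace ℝ (Fin 2)) (ν : ℝ) (k : ℤ) :
    TrialBound x₀ ν (ν - k) (ball p R) (fun r => f (min r R)) (fun r => f₁ (min r R)) := by
  obtain ⟨C, hC, hb⟩ := h.bound
  obtain ⟨M, hM0, hM⟩ := exists_abs_deriv_smoothTransition_le
  set η := smoothTransition with hη
  have hη0 := smoothTransition.nonneg
  have hη1 := smoothTransition.le_one
  set S : ℕ → ℝ → ℝ := fun n r => 2 * (n + 1) * (1 - r / R) with hS
  set G : ℕ → ℝ → ℝ := fun n r => f R + η (S n r) * (f r - f R) with hG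
  set G' : ℕ → ℝ → ℝ := fun n r =>
    (deriv η (S n r) * (2 * (n + 1) * (-1 / R))) * (f r - f R) + η (S n r) * f₁ r with hG'
  have hsm : ∀ n, ContDiffOn ℝ ∞ (G n) (Ioi 0) := fun n => by
    refine contDiffOn_const.add (ContDiffOn.mul ?_ (h.contDiffOn.sub contDiffOn_const))
    refine (ContDiff.comp (g := η) smoothTransition.contDiff (f := S n) ?_).contDiffOn
    simp only [hS]
    fun_prop
  have hder : ∀ n r, 0 < r → HasDerivAt (G n) (G' n r) r := fun n r hr => by
    refine HasDerivAt.const_add _ (HasDerivAt.mul ?_ ((h.hasDerivAt r hr).sub_const _))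
    have h1 : HasDerivAt (S n) (2 * (n + 1) * (-1 / R)) r := by
      have := (((hasDerivAt_id r).div_const R).const_sub 1).const_mul (2 * ((n : ℝ) + 1))
      simpa [neg_div] using this
    exact (hasDerivAt_smoothTransition _).comp r h1
  have hS0 : ∀ n r, R ≤ r → S n r ≤ 0 := fun n r hr => by
    have h1 : 1 ≤ r / R := (one_le_div hR).2 hr
    exact mul_nonpos_of_nonneg_of_nonpos (by positivity) (by linarith)
  have hout : ∀ n r, R ≤ r → G n r = f R := fun n r hr => by
    simp [hG, hη, smoothTransition.zero_of_nonpos (hS0 n r hr)]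
  have hout' : ∀ n r, R ≤ r → G' n r = 0 := fun n r hr => by
    simp [hG', hη, smoothTransition.zero_of_nonpos (hS0 n r hr),
      deriv_smoothTransition_eq_zero (Or.inl (hS0 n r hr))]
  have hfR : 0 < f R := h.pos R hR le_rfl
  have hbG : ∀ n r, 0 < r → |G n r| ≤ (2 + M) * C * r ^ d := by
    intro n r hr
    have hrd : 0 < r ^ d := by positivity
    suffices hs : |G n r| ≤ 2 * C * r ^ d by
      have : 0 ≤ M * C * r ^ d := by positivity
      linarith
    by_cases hr2 : R / 2 ≤ r
    · have h1 : f R ≤ 2 * C * r ^ d := by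
        calc f R ≤ C * R ^ d := (hb R hR le_rfl).1
          _ ≤ C * (2 * r) ^ d := by gcongr; linarith
          _ = C * 2 ^ d * r ^ d := by rw [mul_rpow (by norm_num) hr.le]; ring
          _ ≤ C * 2 ^ (1 : ℝ) * r ^ d := by
              gcongr; norm_num
          _ = _ := by rw [rpow_one]; ring
      rcases le_total R r with hRr | hrR
      · rw [hout n r hRr, abs_of_pos hfR]; exact h1
      · obtain ⟨h2, -⟩ := h.sub_le hd1 hC (fun r hr hrR => (hb r hr hrR).2) hr hrR
        have h3 := h.pos r hr hrR
        have h4 := hη0 (S n r)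
        have h5 := hη1 (S n r)
        rw [abs_le]
        constructor
        · simp only [hG]; nlinarith
        · simp only [hG]; nlinarith
    · push Not at hr2
      have h2 : 1 ≤ S n r := by
        have h3 : r / R < 1 / 2 := by rw [div_lt_iff₀ hR]; linarith
        have h4 : (0 : ℝ) ≤ n := by positivity
        simp only [hS]; nlinarith
      have h3 : G n r = f r := by simp [hG, hη, smoothTransition.one_of_one_le h2]
      rw [h3, abs_of_pos (h.pos r hr (by linarith))]
      have := (hb r hr (by linarith)).1
      nlinarith [mul_nonneg hC hrd.le]
  have hbG' : ∀ n r, 0 < r → |G' n r| ≤ (2 + M) * C * r ^ (d - 1) := by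
    intro n r hr
    have hrd : 0 < r ^ (d - 1) := by positivity
    rcases le_total R r with hRr | hrR
    · rw [hout' n r hRr, abs_zero]; positivity
    have h1 : |η (S n r) * f₁ r| ≤ C * r ^ (d - 1) := by
      have hf₁ := h.nonneg₁ r hr hrR
      rw [abs_of_nonneg (mul_nonneg (hη0 _) hf₁)]
      exact (mul_le_of_le_one_left hf₁ (hη1 _)).trans (hb r hr hrR).2
    have h2 : |deriv η (S n r) * (2 * (n + 1) * (-1 / R)) * (f r - f R)| ≤
        M * (C * r ^ (d - 1)) := by
      by_cases hs : S n r ≤ 0 ∨ 1 ≤ S n r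
      · rw [hη, deriv_smoothTransition_eq_zero hs]
        simp only [zero_mul, abs_zero]
        positivity
      · push Not at hs
        obtain ⟨h3, h4⟩ := h.sub_le hd1 hC (fun r hr hrR => (hb r hr hrR).2) hr hrR
        have h5 : deriv η (S n r) * (2 * (n + 1) * (-1 / R)) * (f r - f R)
            = deriv η (S n r) * (2 * (n + 1) / R * (f R - f r)) := by ring
        rw [h5, abs_mul, abs_of_nonneg (a := 2 * (n + 1) / R * (f R - f r)) (by positivity)]
        refine mul_le_mul (hM _) ?_ (by positivity) hM0
        calc 2 * (n + 1) / R * (f R - f r) ≤ 2 * (n + 1) / R * (C * r ^ (d - 1) * (R - r)) := by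
              gcongr
          _ = C * r ^ (d - 1) * S n r := by simp only [hS]; field_simp
          _ ≤ C * r ^ (d - 1) * 1 := by gcongr; exact hs.2.le
          _ = _ := mul_one _
    refine (abs_add_le _ _).trans ?_
    nlinarith [mul_nonneg hC hrd.le]
  have hev1 : ∀ r, r < R → ∀ᶠ n : ℕ in atTop, 1 ≤ S n r := fun r hr => by
    have hpos : 0 < 1 - r / R := by rw [sub_pos, div_lt_one hR]; exact hr
    filter_upwards [eventually_ge_atTop ⌈1 / (1 - r / R)⌉₊] with n hn
    have h1 : 1 / (1 - r / R) ≤ n := (Nat.le_ceil _).trans (by exact_mod_cast hn)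
    rw [div_le_iff₀ hpos] at h1
    have h4 : (0 : ℝ) ≤ n := by positivity
    simp only [hS]; nlinarith
  refine trialBound_of_tendsto hd (G := G) (G' := G') (fun n => (hsm n).continuousOn)
    (fun n => continuousOn_of_contDiffOn_of_hasDerivAt (hsm n) (hder n)) hbG hbG' ?_ ?_
    fun n => trialBound_of_bound hd (hsm n) (hder n) (by positivity) (hbG n) (hbG' n)
  · intro r hr
    rcases lt_or_ge r R with hrR | hRr
    · refine tendsto_const_nhds.congr' ((hev1 r hrR).mono fun n hn => ?_)
      simp [hG, hη, smoothTransition.one_of_one_le hn, min_eq_left hrR.le]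
    · simp only [hout _ r hRr, min_eq_right hRr]
      exact tendsto_const_nhds
  · intro r hr
    rcases lt_or_ge r R with hrR | hRr
    · refine tendsto_const_nhds.congr' ((hev1 r hrR).mono fun n hn => ?_)
      simp [hG', hη, smoothTransition.one_of_one_le hn, deriv_smoothTransition_eq_zero (Or.inr hn),
        min_eq_left hrR.le]
    · simp only [hout' _ r hRr, min_eq_right hRr, h.neumann]
      exact tendsto_const_nhds

end Cutoff

section Comparison

open Set Real Metric Filter Topology
open scoped ContDiff

namespace RadialProfile

variable {d R Λ : ℝ} {f f₁ : ℝ → ℝ}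

theorem exists_bound_truncation (h : RadialProfile d R Λ f f₁) (hd : 0 ≤ d) (hR : 0 < R) :
    ∃ C, 0 ≤ C ∧ ∀ r, 0 < r → |f (min r R)| ≤ C * r ^ d ∧ |f₁ (min r R)| ≤ C * r ^ (d - 1) := by
  obtain ⟨C, hC, hb⟩ := h.bound
  refine ⟨C, hC, fun r hr => ?_⟩
  have hm : 0 < min r R := lt_min hr hR
  have hmR : min r R ≤ R := min_le_right _ _
  rw [abs_of_pos (h.pos _ hm hmR), abs_of_nonneg (h.nonneg₁ _ hm hmR)]
  refine ⟨(hb _ hm hmR).1.trans ?_, ?_⟩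
  · gcongr; exact min_le_left _ _
  · rcases le_total r R with hrR | hRr
    · rw [min_eq_left hrR]; exact (hb r hr hrR).2
    · rw [min_eq_right hRr, h.neumann]; positivity

theorem continuousOn_truncation (h : RadialProfile d R Λ f f₁) (hR : 0 < R) :
    ContinuousOn (fun r => f (min r R)) (Ioi 0) ∧ ContinuousOn (fun r => f₁ (min r R)) (Ioi 0) := by
  have hm : MapsTo (fun r => min r R) (Ioi 0) (Ioi 0) := fun r hr => lt_min hr hR
  have hc : ContinuousOn (fun r : ℝ => min r R) (Ioi 0) := by fun_prop
  exact ⟨h.contDiffOn.continuousOn.comp hc hm,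
    (continuousOn_of_contDiffOn_of_hasDerivAt h.contDiffOn h.hasDerivAt).comp hc hm⟩

theorem integrableOn_truncation (h : RadialProfile d R Λ f f₁) (hd : 0 < d) (hR : 0 < R)
    (x₀ p : EuclideanSpace ℝ (Fin 2)) (ρ : ℝ) :
    IntegrableOn (fun x => f (min ‖x - x₀‖ R) ^ 2) (ball p ρ) ∧
    IntegrableOn (fun x => f₁ (min ‖x - x₀‖ R) ^ 2) (ball p ρ) ∧
    IntegrableOn (fun x => f (min ‖x - x₀‖ R) ^ 2 / ‖x - x₀‖ ^ 2) (ball p ρ) := by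
  obtain ⟨C, hC, hb⟩ := h.exists_bound_truncation hd.le hR
  obtain ⟨hc, hc₁⟩ := h.continuousOn_truncation hR
  have hsq : ∀ {y c : ℝ}, |y| ≤ c → y ^ 2 ≤ c ^ 2 := fun {y c} hy => by
    rw [← sq_abs y]; exact pow_le_pow_left₀ (abs_nonneg y) hy 2
  have hp : ∀ (a : ℝ) {r : ℝ}, 0 < r → (C * r ^ a) ^ 2 = C ^ 2 * r ^ (2 * a) := fun a r hr => by
    rw [mul_pow, ← rpow_mul_natCast hr.le, mul_comm a]; norm_num
  have hr0 : ∀ x : EuclideanSpace ℝ (Fin 2), x ≠ x₀ → 0 < ‖x - x₀‖ := fun x hx =>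
    norm_pos_iff.2 (sub_ne_zero.2 hx)
  refine ⟨?_, ?_, ?_⟩
  · refine ((integrableOn_norm_sub_rpow (a := 2 * d) (by linarith) x₀ p ρ).const_mul (C ^ 2)).mono'
      (aestronglyMeasurable_comp_norm_sub (hc.pow 2) _ _) ?_
    filter_upwards [ae_ne_pole x₀ (ball p ρ)] with x hx
    rw [norm_of_nonneg (by positivity), ← hp d (hr0 x hx)]
    exact hsq (hb _ (hr0 x hx)).1
  · refine ((integrableOn_norm_sub_rpow (a := 2 * (d - 1)) (by linarith) x₀ p ρ).const_mul
      (C ^ 2)).mono' (aestronglyMeasurable_comp_norm_sub (hc₁.pow 2) _ _) ?_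
    filter_upwards [ae_ne_pole x₀ (ball p ρ)] with x hx
    rw [norm_of_nonneg (by positivity), ← hp _ (hr0 x hx)]
    exact hsq (hb _ (hr0 x hx)).2
  · refine ((integrableOn_norm_sub_rpow (a := 2 * (d - 1)) (by linarith) x₀ p ρ).const_mul
      (C ^ 2)).mono' (aestronglyMeasurable_comp_norm_sub
        (ψ := fun r => f (min r R) ^ 2 / r ^ 2) ((hc.pow 2).div (continuousOn_id.pow 2)
          fun r hr => pow_ne_zero 2 (ne_of_gt hr)) _ _) ?_
    filter_upwards [ae_ne_pole x₀ (ball p ρ)] with x hx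
    have hr := hr0 x hx
    rw [norm_of_nonneg (by positivity), ← hp _ hr, ← div_pow]
    refine hsq ?_
    rw [abs_div, abs_of_pos hr, rpow_sub_one hr.ne', ← mul_div_assoc]
    gcongr
    exact (hb _ hr).1

theorem integrableOn_excess (h : RadialProfile d R Λ f f₁) (hd : 0 < d) (hR : 0 < R)
    (x₀ p : EuclideanSpace ℝ (Fin 2)) (ρ : ℝ) :
    IntegrableOn (fun x => excess d R Λ f f₁ ‖x - x₀‖) (ball p ρ) := by
  obtain ⟨h1, h2, h3⟩ := h.integrableOn_truncation hd hR x₀ p ρ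
  refine ((h2.add (h3.const_mul (d ^ 2))).sub (h1.const_mul Λ)).congr
    (Eventually.of_forall fun x => ?_)
  simp [excess, mul_div_assoc]

theorem setIntegral_excess_center (h : RadialProfile d R Λ f f₁) (hd : 0 < d) (hR : 0 < R)
    (x₀ : EuclideanSpace ℝ (Fin 2)) :
    ∫ x in ball x₀ R, excess d R Λ f f₁ ‖x - x₀‖ = 0 := by
  set H := excess d R Λ f f₁ with hH
  have hint : IntegrableOn (fun y => y * H y) (Ioo 0 R) := by
    have := h.integrableOn_excess hd hR 0 0 R
    simp only [sub_zero] at this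
    simpa using (integrableOn_fun_norm_addHaar volume).1 this
  have e1 : ∫ x in ball x₀ R, H ‖x - x₀‖
      = ∫ x : EuclideanSpace ℝ (Fin 2), (Iio R).indicator H ‖x‖ := by
    rw [← integral_indicator measurableSet_ball,
      ← integral_sub_right_eq_self (fun x => (Iio R).indicator H ‖x‖) x₀]
    congr 1
  have e2 : ∫ y in (0 : ℝ)..R, y * H y = 0 := by
    obtain ⟨C, hC, hb⟩ := h.bound
    have hder : ∀ y, 0 < y → HasDerivAt (fun y => y * f y * f₁ y)
        ((1 * f y + y * f₁ y) * f₁ y + y * f y * (-f₁ y / y + d ^ 2 * f y / y ^ 2 - Λ * f y)) y :=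
      fun y hy => ((hasDerivAt_id y).mul (h.hasDerivAt y hy)).mul (h.hasDerivAt₁ y hy)
    have key := intervalIntegral.integral_eq_sub_of_hasDerivAt_of_tendsto
      (f := fun y => y * f y * f₁ y) (f' := fun y => y * H y) (fa := 0) (fb := 0) hR
      (fun y hy => (hder y hy.1).congr_deriv ?_)
      ((intervalIntegrable_iff_integrableOn_Ioo_of_le hR.le).2 hint) ?_ ?_
    · rw [key, sub_zero]
    · have hy0 := hy.1
      simp only [hH, excess, min_eq_left hy.2.le]
      field_simp
      ring
    · have hlim : Tendsto (fun y : ℝ => C ^ 2 * y ^ (2 * d)) (𝓝[>] 0) (𝓝 0) := by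
        have h1 : Tendsto (fun y : ℝ => C ^ 2 * y ^ (2 * d)) (𝓝 0) (𝓝 (C ^ 2 * 0 ^ (2 * d))) :=
          ((continuousAt_rpow_const 0 (2 * d) (Or.inr (by linarith))).const_mul (C ^ 2))
        rw [zero_rpow (by linarith), mul_zero] at h1
        exact h1.mono_left nhdsWithin_le_nhds
      refine squeeze_zero' ?_ ?_ hlim
      · filter_upwards [Ioo_mem_nhdsGT hR] with y hy
        exact mul_nonneg (mul_nonneg hy.1.le (h.pos y hy.1 hy.2.le).le)
          (h.nonneg₁ y hy.1 hy.2.le)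
      · filter_upwards [Ioo_mem_nhdsGT hR] with y hy
        have hy0 := hy.1
        have h1 := hb y hy.1 hy.2.le
        have h2 := h.nonneg₁ y hy.1 hy.2.le
        calc y * f y * f₁ y ≤ y * (C * y ^ d) * (C * y ^ (d - 1)) := by
              gcongr
              · exact h1.1
              · exact h1.2
          _ = C ^ 2 * y ^ (2 * d) := by
              rw [rpow_sub_one hy0.ne', two_mul, rpow_add hy0]
              field_simp
    · have h1 := (hder R hR).continuousAt.tendsto
      simp only [h.neumann, mul_zero] at h1
      exact h1.mono_left nhdsWithin_le_nhds
  have e3 : ∫ y in Ioi (0 : ℝ), y * (Iio R).indicator H y = ∫ y in (0 : ℝ)..R, y * H y := by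
    rw [intervalIntegral.integral_of_le hR.le, integral_Ioc_eq_integral_Ioo,
      ← Ioi_inter_Iio, ← setIntegral_indicator measurableSet_Iio]
    congr 1
    ext y
    simp [indicator]
  rw [e1, integral_fun_norm_addHaar]
  simp [e3, e2]

theorem setIntegral_excess_le (h : RadialProfile d R Λ f f₁) (hd : 0 < d) (hd1 : d ≤ 1)
    (hΛ : 0 < Λ) (hR : 0 < R) (x₀ p : EuclideanSpace ℝ (Fin 2)) :
    ∫ x in ball p R, excess d R Λ f f₁ ‖x - x₀‖ ≤ 0 := by
  set H := excess d R Λ f f₁ with hH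
  have hi : ∀ q : EuclideanSpace ℝ (Fin 2), IntegrableOn (fun x => H ‖x - x₀‖ - H R) (ball q R) :=
    fun q => (h.integrableOn_excess hd hR x₀ q R).sub
      (integrableOn_const measure_ball_lt_top.ne)
  have hmono : ∫ x in ball p R, (H ‖x - x₀‖ - H R) ≤ ∫ x in ball x₀ R, (H ‖x - x₀‖ - H R) := by
    rw [← integral_indicator measurableSet_ball, ← integral_indicator measurableSet_ball]
    refine integral_mono_ae ((hi p).integrable_indicator measurableSet_ball)
      ((hi x₀).integrable_indicator measurableSet_ball) ?_
    filter_upwards [Measure.ae_ne volume x₀] with x hx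
    have hr : 0 < ‖x - x₀‖ := norm_pos_iff.2 (sub_ne_zero.2 hx)
    by_cases hxR : ‖x - x₀‖ < R
    · have hle := h.le_excess hΛ (by nlinarith) hr hxR.le
      rw [indicator_of_mem (s := ball x₀ R) (by rwa [mem_ball, dist_eq_norm])]
      exact indicator_le_self' (fun _ _ => sub_nonneg.2 hle) x
    · have hle := excess_le (d := d) (Λ := Λ) (f := f) (f₁ := f₁) hR (not_lt.1 hxR)
      rw [indicator_of_notMem (s := ball x₀ R) (by rwa [mem_ball, dist_eq_norm])]
      exact indicator_nonpos (fun _ _ => sub_nonpos.2 hle) x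
  have hsub : ∀ q : EuclideanSpace ℝ (Fin 2), ∫ x in ball q R, (H ‖x - x₀‖ - H R)
      = (∫ x in ball q R, H ‖x - x₀‖)
        - volume.real (ball (0 : EuclideanSpace ℝ (Fin 2)) R) * H R := fun q => by
    rw [integral_sub (h.integrableOn_excess hd hR x₀ q R)
      (integrableOn_const measure_ball_lt_top.ne), setIntegral_const,
      Measure.addHaar_real_ball_center, smul_eq_mul]
  rw [hsub, hsub, h.setIntegral_excess_center hd hR x₀] at hmono
  linarith

theorem lambda1_le (h : RadialProfile d R Λ f f₁) (hd : 0 < d) (hd1 : d ≤ 1) (hΛ : 0 < Λ)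
    (hR : 0 < R) (x₀ p : EuclideanSpace ℝ (Fin 2)) {ν : ℝ} {k : ℤ} (hν : |ν - k| ≤ d) :
    lambda1 x₀ ν (ball p R) ≤ Λ := by
  obtain ⟨h1, h2, h3⟩ := h.integrableOn_truncation hd hR x₀ p R
  have htrial := h.trialBound hd hd1 hR x₀ p ν k
  rw [TrialBound] at htrial
  simp only [mul_div_assoc] at htrial
  rw [integral_add h2 (h3.const_mul _), integral_const_mul] at htrial
  have hex := h.setIntegral_excess_le hd hd1 hΛ hR x₀ p
  simp only [excess, mul_div_assoc] at hex
  have h23 : IntegrableOn (fun x => f₁ (min ‖x - x₀‖ R) ^ 2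
      + d ^ 2 * (f (min ‖x - x₀‖ R) ^ 2 / ‖x - x₀‖ ^ 2)) (ball p R) := h2.add (h3.const_mul _)
  rw [integral_sub h23 (h1.const_mul _), integral_add h2 (h3.const_mul _), integral_const_mul,
    integral_const_mul] at hex
  have hδ : (ν - k) ^ 2 ≤ d ^ 2 := by
    rw [← sq_abs (ν - k)]; exact pow_le_pow_left₀ (abs_nonneg _) hν 2
  have h4 : 0 ≤ ∫ x in ball p R, f (min ‖x - x₀‖ R) ^ 2 / ‖x - x₀‖ ^ 2 :=
    integral_nonneg fun x => by positivity
  have h5 := mul_le_mul_of_nonneg_right hδ h4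
  have hpos : 0 < ∫ x in ball p R, f (min ‖x - x₀‖ R) ^ 2 := by
    rw [integral_pos_iff_support_of_nonneg (fun x => sq_nonneg _) h1]
    have hae : ∀ᵐ x ∂(volume.restrict (ball p R)),
        x ∈ Function.support fun x => f (min ‖x - x₀‖ R) ^ 2 := by
      filter_upwards [ae_ne_pole x₀ (ball p R)] with x hx
      exact pow_ne_zero 2 (h.pos _ (lt_min (norm_pos_iff.2 (sub_ne_zero.2 hx)) hR)
        (min_le_right _ _)).ne'
    have hfull : (Function.support fun x => f (min ‖x - x₀‖ R) ^ 2)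
        =ᵐ[volume.restrict (ball p R)] univ := eventuallyEq_univ.2 hae
    rw [measure_congr hfull, Measure.restrict_apply_univ]
    exact measure_ball_pos _ _ hR
  refine le_of_mul_le_mul_right ?_ hpos
  linarith

end RadialProfile

theorem exists_vanishesNear_setIntegral_pos (x₀ : EuclideanSpace ℝ (Fin 2)) {R : ℝ} (hR : 0 < R) :
    ∃ u : EuclideanSpace ℝ (Fin 2) → ℂ, ContDiff ℝ ∞ u ∧ VanishesNear x₀ u ∧
      0 < ∫ x in ball x₀ R, ‖u x‖ ^ 2 := by
  let χ : ContDiffBump x₀ := ⟨R / 4, R / 2, by linarith, by linarith⟩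
  have hsm : ContDiff ℝ ∞ (fun x => ((1 - χ x : ℝ) : ℂ)) :=
    Complex.ofRealCLM.contDiff.comp (contDiff_const.sub χ.contDiff)
  refine ⟨fun x => ((1 - χ x : ℝ) : ℂ), hsm, ⟨R / 4, by linarith, fun x hx => ?_⟩, ?_⟩
  · simp [χ.one_of_mem_closedBall (ball_subset_closedBall hx)]
  · have hc : Continuous fun x => ‖((1 - χ x : ℝ) : ℂ)‖ ^ 2 := hsm.continuous.norm.pow 2
    rw [setIntegral_pos_iff_support_of_nonneg_ae (Eventually.of_forall fun x => sq_nonneg _)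
      ((hc.continuousOn.integrableOn_compact (isCompact_closedBall x₀ R)).mono_set
        ball_subset_closedBall)]
    set y : EuclideanSpace ℝ (Fin 2) := x₀ + EuclideanSpace.single 0 (3 * R / 4) with hy
    have hyd : dist y x₀ = 3 * R / 4 := by
      rw [dist_eq_norm, hy, add_sub_cancel_left, PiLp.norm_single,
        norm_of_nonneg (by positivity)]
    refine (hc.isOpen_support.inter isOpen_ball).measure_pos volume ⟨y, ?_, ?_⟩
    · rw [Function.mem_support, χ.zero_of_le_dist (show R / 2 ≤ dist y x₀ by rw [hyd]; linarith)]
      simp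
    · rw [mem_ball, hyd]; linarith

theorem lambda1_nonneg (x₀ : EuclideanSpace ℝ (Fin 2)) (ν : ℝ)
    (D : Set (EuclideanSpace ℝ (Fin 2))) : 0 ≤ lambda1 x₀ ν D := by
  refine Real.sInf_nonneg ?_
  rintro q ⟨u, -, -, hu, rfl⟩
  exact div_nonneg (integral_nonneg fun x => Finset.sum_nonneg fun i _ => sq_nonneg _) hu.le

theorem RadialProfile.le_lambda1 {d R Λ ν : ℝ} {f f₁ : ℝ → ℝ} (h : RadialProfile d R Λ f f₁)
    (hR : 0 < R) (hd : 0 ≤ d) (hν : ∀ m : ℤ, d ≤ |ν - m|) (x₀ : EuclideanSpace ℝ (Fin 2)) :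
    Λ ≤ lambda1 x₀ ν (ball x₀ R) := by
  obtain ⟨u, hu, hu0, hpos⟩ := exists_vanishesNear_setIntegral_pos x₀ hR
  refine le_csInf ⟨_, u, hu, hu0, hpos, rfl⟩ ?_
  rintro q ⟨v, hv, hv0, hvpos, rfl⟩
  rw [le_div_iff₀ hvpos]
  exact h.le_magnetic_energy hR hd hν hv hv0

theorem lambda1_ball_le_of_integer_flux (p x₀ : EuclideanSpace ℝ (Fin 2)) {R : ℝ} (hR : 0 < R)
    (k : ℤ) : lambda1 x₀ k (ball p R) ≤ 0 := by
  have hlim : Tendsto (fun d : ℝ => 4 * d / R ^ 2) (𝓝[>] 0) (𝓝 0) := by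
    have h1 : Continuous fun d : ℝ => 4 * d / R ^ 2 := by fun_prop
    have h2 := h1.tendsto 0
    simp only [mul_zero, zero_div] at h2
    exact h2.mono_left nhdsWithin_le_nhds
  refine ge_of_tendsto hlim ?_
  filter_upwards [Ioo_mem_nhdsGT (show (0 : ℝ) < 1 / 2 by norm_num)] with d hd
  obtain ⟨Λ, f, f₁, hΛ, hΛd, h⟩ := exists_radialProfile hd.1 hd.2.le hR
  exact (h.lambda1_le hd.1 (by linarith [hd.2]) hΛ hR x₀ p (k := k)
    (by simpa using hd.1.le)).trans hΛd

end Comparison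

/-- Among all disks of the same radius containing the pole, the first magnetic Neumann
eigenvalue of the Aharonov–Bohm operator is maximized by the disk centered at the pole. -/
theorem neumann_punctured_disk (p x₀ : EuclideanSpace ℝ (Fin 2)) (R : ℝ) (hR : 0 < R)
    (hx₀ : x₀ ∈ Metric.ball p R) (ν : ℝ) :
    lambda1 x₀ ν (Metric.ball p R) ≤ lambda1 x₀ ν (Metric.ball x₀ R) := by
  rcases (abs_nonneg (ν - round ν)).eq_or_lt with h0 | h0
  · rw [sub_eq_zero.1 (abs_eq_zero.1 h0.symm)]
    exact (lambda1_ball_le_of_integer_flux p x₀ hR _).trans (lambda1_nonneg _ _ _)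
  · have h2 := abs_sub_round ν
    obtain ⟨Λ, f, f₁, hΛ, -, h⟩ := exists_radialProfile h0 h2 hR
    exact (h.lambda1_le h0 (by linarith) hΛ hR x₀ p le_rfl).trans
      (h.le_lambda1 hR h0.le (fun m => round_le ν m) x₀)
end

section
/- Let ν ∈ ℝ and let u : ℝ → ℂ be a continuously differentiable 2π-periodic function. Then ∫₀^{2π} |u'(t) − i ν u(t)|² dt ≥ d(ν,ℤ)² · ∫₀^{2π} |u(t)|² dt, where d(ν,ℤ) = inf_{k ∈ ℤ} |ν − k|. -/
lemma distInt_nonneg (ν : ℝ) : 0 ≤ distInt ν :=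
  Real.iInf_nonneg fun _ => abs_nonneg _

lemma distInt_le (ν : ℝ) (k : ℤ) : distInt ν ≤ |ν - k| :=
  ciInf_le ⟨0, by rintro _ ⟨k, rfl⟩; exact abs_nonneg _⟩ k

/-- A continuous function is square integrable on a bounded interval. -/
lemma Continuous.memLp_two_restrict_Ioc {f : ℝ → ℂ} (hf : Continuous f) (a b : ℝ) :
    MeasureTheory.MemLp f 2 (MeasureTheory.volume.restrict (Set.Ioc a b)) := by
  rw [MeasureTheory.memLp_two_iff_integrable_sq_norm hf.aestronglyMeasurable]
  exact (hf.norm.pow 2).integrableOn_Ioc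

/-- The magnetic derivative `u' - iνu` acts on the `n`-th Fourier coefficient of a periodic
function as multiplication by `i(n - ν)`. -/
lemma fourierCoeffOn_deriv_sub (ν : ℝ) {u : ℝ → ℂ} (hu : ContDiff ℝ 1 u)
    (hper : Function.Periodic u (2 * Real.pi)) (n : ℤ) :
    fourierCoeffOn Real.two_pi_pos (fun t => deriv u t - Complex.I * ν * u t) n =
      Complex.I * (n - ν) * fourierCoeffOn Real.two_pi_pos u n := by
  have hc : Continuous u := hu.continuous
  have hd : Continuous (deriv u) := hu.continuous_deriv le_rfl
  set e : ℝ → ℂ := fun t => fourier (-n) (t : AddCircle (2 * Real.pi - 0)) with he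
  have hder (t : ℝ) : HasDerivAt e (-(Complex.I * n) * e t) t := by
    convert hasDerivAt_fourier_neg (2 * Real.pi - 0) n t using 1
    have : (Real.pi : ℂ) ≠ 0 := by exact_mod_cast Real.pi_ne_zero
    simp only [he, sub_zero]
    push_cast
    field_simp
  have hec : Continuous e := continuous_iff_continuousAt.2 fun t => (hder t).continuousAt
  have hprod (t : ℝ) :
      HasDerivAt (fun t => e t * u t) (e t * (deriv u t - Complex.I * n * u t)) t := by
    refine ((hder t).mul ((hu.differentiable one_ne_zero) t).hasDerivAt).congr_deriv ?_
    ring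
  have hzero : ∫ t in (0 : ℝ)..(2 * Real.pi), e t * (deriv u t - Complex.I * n * u t) = 0 := by
    rw [intervalIntegral.integral_eq_sub_of_hasDerivAt (fun t _ => hprod t)
      (Continuous.intervalIntegrable (by fun_prop) _ _)]
    have h1 : e (2 * Real.pi) = e 0 := by
      simpa [he] using congrArg (fourier (-n)) (AddCircle.coe_period (2 * Real.pi - 0))
    have h2 : u (2 * Real.pi) = u 0 := by simpa using hper 0
    rw [h1, h2, sub_self]
  have hsplit : ∫ t in (0 : ℝ)..(2 * Real.pi), e t * (deriv u t - Complex.I * ν * u t) =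
      Complex.I * (n - ν) * ∫ t in (0 : ℝ)..(2 * Real.pi), e t * u t := by
    rw [← intervalIntegral.integral_const_mul, ← sub_eq_zero,
      ← intervalIntegral.integral_sub (Continuous.intervalIntegrable (by fun_prop) _ _)
        (Continuous.intervalIntegrable (by fun_prop) _ _), ← hzero]
    congr 1 with t
    ring
  rw [fourierCoeffOn_eq_integral, fourierCoeffOn_eq_integral]
  simp only [smul_eq_mul]
  rw [hsplit, mul_smul_comm]


/-- The one-dimensional (angular) spectral inequality on the circle: for a C¹,
2π-periodic function u, ∫₀^{2π} |u' − iνu|² ≥ d(ν,ℤ)² ∫₀^{2π} |u|². -/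
theorem angular_spectral_inequality (ν : ℝ) (u : ℝ → ℂ)
    (hu : ContDiff ℝ 1 u) (hper : Function.Periodic u (2 * Real.pi)) :
    ∫ t in (0 : ℝ)..(2 * Real.pi), ‖deriv u t - Complex.I * ν * u t‖ ^ 2 ≥
      distInt ν ^ 2 * ∫ t in (0 : ℝ)..(2 * Real.pi), ‖u t‖ ^ 2 := by
  have hc : Continuous u := hu.continuous
  have hd : Continuous (deriv u) := hu.continuous_deriv le_rfl
  have hg : Continuous fun t => deriv u t - Complex.I * ν * u t := by fun_prop
  have hparseval := (hasSum_sq_fourierCoeffOn Real.two_pi_pos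
    (hc.memLp_two_restrict_Ioc 0 (2 * Real.pi))).mul_left (distInt ν ^ 2)
  have hle := hasSum_le (fun n => ?_) hparseval
    (hasSum_sq_fourierCoeffOn Real.two_pi_pos (hg.memLp_two_restrict_Ioc 0 (2 * Real.pi)))
  · rw [mul_smul_comm, sub_zero] at hle
    exact le_of_smul_le_smul_left hle (inv_pos.2 Real.two_pi_pos)
  · rw [fourierCoeffOn_deriv_sub ν hu hper, norm_mul, mul_pow]
    have hnorm : ‖Complex.I * ((n : ℂ) - ν)‖ = |ν - n| := by
      rw [norm_mul, Complex.norm_I, one_mul, norm_sub_rev]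
      exact_mod_cast Complex.norm_real (ν - n)
    rw [hnorm]
    gcongr
    · exact distInt_nonneg ν
    · exact distInt_le ν n
end

section
/- Let R > 0, let θ, V : (0,R) → ℝ be differentiable with θ > 0, V ≥ 0, V' < 0 and θ'(r)V'(r) + 2V(r)²θ(r) ≤ 0 for all r ∈ (0,R), and let λ ≥ 0. Let u : (0,R) → ℝ be twice differentiable with u ≥ 0 and u' ≥ 0 on (0,R), satisfying the equation u''(r) + (θ'(r)/θ(r)) u'(r) + (λ − V(r)) u(r) = 0 on (0,R). Then the function F(r) = u'(r)² + V(r) u(r)² satisfies F'(r) ≤ 0 for all r ∈ (0,R). -/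
open Set

/-- A real binary quadratic form with negative leading coefficient and nonpositive discriminant
is nonpositive. -/
theorem quadratic_form_nonpos {a b c : ℝ} (ha : a < 0) (hdisc : b ^ 2 ≤ a * c) (x y : ℝ) :
    a * x ^ 2 + 2 * b * (x * y) + c * y ^ 2 ≤ 0 := by
  have h : 0 ≤ a * (a * x ^ 2 + 2 * b * (x * y) + c * y ^ 2) := by
    have h2 := mul_nonneg (sub_nonneg.2 hdisc) (sq_nonneg y)
    linarith [sq_nonneg (a * x + b * y)]
  exact nonpos_of_mul_nonneg_right h ha

/-- Monotonicity of the radial energy density F = u'² + Vu² for radial solutions of the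
Schrödinger equation u'' + (θ'/θ)u' + (λ − V)u = 0 on a manifold of revolution. -/
theorem radial_energy_monotone (R : ℝ) (hR : 0 < R) (θ V u : ℝ → ℝ) (lam : ℝ)
    (hθd : ∀ r ∈ Ioo 0 R, DifferentiableAt ℝ θ r)
    (hVd : ∀ r ∈ Ioo 0 R, DifferentiableAt ℝ V r)
    (hθpos : ∀ r ∈ Ioo 0 R, 0 < θ r)
    (hVpos : ∀ r ∈ Ioo 0 R, 0 ≤ V r)
    (hV' : ∀ r ∈ Ioo 0 R, deriv V r < 0)
    (hcond : ∀ r ∈ Ioo 0 R, deriv θ r * deriv V r + 2 * (V r) ^ 2 * θ r ≤ 0)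
    (hlam : 0 ≤ lam)
    (hud : ∀ r ∈ Ioo 0 R, DifferentiableAt ℝ u r)
    (hud2 : ∀ r ∈ Ioo 0 R, DifferentiableAt ℝ (deriv u) r)
    (hupos : ∀ r ∈ Ioo 0 R, 0 ≤ u r)
    (hu'pos : ∀ r ∈ Ioo 0 R, 0 ≤ deriv u r)
    (heq : ∀ r ∈ Ioo 0 R,
      deriv (deriv u) r + (deriv θ r / θ r) * deriv u r + (lam - V r) * u r = 0) :
    ∀ r ∈ Ioo 0 R, deriv (fun s => (deriv u s) ^ 2 + V s * (u s) ^ 2) r ≤ 0 := by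
  intro r hr
  have hF := (((hud2 r hr).hasDerivAt.fun_pow 2).fun_add
    ((hVd r hr).hasDerivAt.fun_mul ((hud r hr).hasDerivAt.fun_pow 2))).deriv
  rw [hF]
  have hθ := hθpos r hr
  have hdisc : (2 * V r) ^ 2 ≤ deriv V r * (-2 * (deriv θ r / θ r)) := by
    have h := div_nonpos_of_nonpos_of_nonneg (hcond r hr) hθ.le
    have he : (deriv θ r * deriv V r + 2 * V r ^ 2 * θ r) / θ r =
        deriv θ r / θ r * deriv V r + 2 * V r ^ 2 := by
      field_simp
    rw [he] at h
    linarith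
  have hQ := quadratic_form_nonpos (hV' r hr) hdisc (u r) (deriv u r)
  have hlamterm := mul_nonneg hlam (mul_nonneg (hupos r hr) (hu'pos r hr))
  have hu'' : deriv (deriv u) r =
      -(deriv θ r / θ r * deriv u r) - (lam - V r) * u r := by
    linarith [heq r hr]
  rw [hu'']
  norm_num
  linarith
end

section
/- Let ν > 0, λ ∈ ℝ, R > 0. Let θ : (0,R] → ℝ be continuously differentiable with θ(r) > 0 and θ'(r) > 0 for all r ∈ (0,R], and θ(r) → 0 as r → 0⁺. Let u : (0,R] → ℝ be twice continuously differentiable with u > 0 on (0,R), satisfying u''(r) + (θ'(r)/θ(r)) u'(r) + (λ − ν²/θ(r)²) u(r) = 0 on (0,R), u'(R) = 0, and θ(r)u'(r) → 0 as r → 0⁺. Then u'(r) > 0 for all r ∈ (0,R), and λ · θ(R)² > ν². -/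
open Set

/-- A function that is strictly increasing on `(a, b]` and tends to `0` at `a⁺` is positive
at `b`. -/
theorem StrictMonoOn.pos_of_tendsto_zero {f : ℝ → ℝ} {a b : ℝ} (hab : a < b)
    (hf : StrictMonoOn f (Ioc a b))
    (h0 : Filter.Tendsto f (nhdsWithin a (Ioi a)) (nhds 0)) : 0 < f b := by
  obtain ⟨m, ham, hmb⟩ := exists_between hab
  have hm : 0 ≤ f m := by
    refine le_of_tendsto h0 ?_
    filter_upwards [Ioo_mem_nhdsGT ham] with s hs
    exact (hf ⟨hs.1, hs.2.le.trans hmb.le⟩ ⟨ham, hmb.le⟩ hs.2).le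
  exact hm.trans_lt (hf ⟨ham, hmb.le⟩ ⟨hab, le_rfl⟩ hmb)

/-- For a radial first eigenfunction of the magnetic Neumann problem with Aharonov–Bohm
flux ν on a geodesic disk of radius R in a manifold of revolution with density θ, the
radial derivative is positive on (0,R) and λ θ(R)² > ν². -/
theorem radial_eigenfunction_increasing (ν lam R : ℝ) (hν : 0 < ν) (hR : 0 < R)
    (θ u : ℝ → ℝ)
    (hθd : ∀ r ∈ Ioc 0 R, DifferentiableAt ℝ θ r)
    (hθ'c : ContinuousOn (deriv θ) (Ioc 0 R))
    (hθpos : ∀ r ∈ Ioc 0 R, 0 < θ r)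
    (hθ'pos : ∀ r ∈ Ioc 0 R, 0 < deriv θ r)
    (hθ0 : Filter.Tendsto θ (nhdsWithin 0 (Ioi 0)) (nhds 0))
    (hud : ∀ r ∈ Ioc 0 R, DifferentiableAt ℝ u r)
    (hud2 : ∀ r ∈ Ioc 0 R, DifferentiableAt ℝ (deriv u) r)
    (hu''c : ContinuousOn (deriv (deriv u)) (Ioc 0 R))
    (hupos : ∀ r ∈ Ioo 0 R, 0 < u r)
    (heq : ∀ r ∈ Ioo 0 R,
      deriv (deriv u) r + (deriv θ r / θ r) * deriv u r + (lam - ν ^ 2 / θ r ^ 2) * u r = 0)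
    (hneu : deriv u R = 0)
    (hN0 : Filter.Tendsto (fun r => θ r * deriv u r) (nhdsWithin 0 (Ioi 0)) (nhds 0)) :
    (∀ r ∈ Ioo 0 R, 0 < deriv u r) ∧ ν ^ 2 < lam * θ R ^ 2 := by
  set N : ℝ → ℝ := fun r => θ r * deriv u r with hN
  have hθmono : StrictMonoOn θ (Ioc 0 R) := by
    refine strictMonoOn_of_deriv_pos (convex_Ioc 0 R)
      (fun r hr => (hθd r hr).continuousAt.continuousWithinAt) fun r hr => ?_
    rw [interior_Ioc] at hr
    exact hθ'pos r ⟨hr.1, hr.2.le⟩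
  have hNc : ContinuousOn N (Ioc 0 R) := fun r hr =>
    ((hθd r hr).mul (hud2 r hr)).continuousAt.continuousWithinAt
  have hNd : ∀ r ∈ Ioo 0 R, deriv N r = (ν ^ 2 - lam * θ r ^ 2) * (u r / θ r) := by
    intro r hr
    have hr' : r ∈ Ioc 0 R := ⟨hr.1, hr.2.le⟩
    have hθr : θ r ≠ 0 := (hθpos r hr').ne'
    have hd : deriv N r = deriv θ r * deriv u r + θ r * deriv (deriv u) r :=
      ((hθd r hr').hasDerivAt.mul (hud2 r hr').hasDerivAt).deriv
    rw [hd]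
    have h := heq r hr
    field_simp at h ⊢
    linear_combination h
  have hNpos : ∀ r ∈ Ioc 0 R, lam * θ r ^ 2 ≤ ν ^ 2 → 0 < N r := by
    intro r hr hle
    refine StrictMonoOn.pos_of_tendsto_zero hr.1 ?_ hN0
    refine strictMonoOn_of_deriv_pos (convex_Ioc 0 r)
      (hNc.mono (Ioc_subset_Ioc_right hr.2)) fun s hs => ?_
    rw [interior_Ioc] at hs
    have hsR : s ∈ Ioo 0 R := ⟨hs.1, hs.2.trans_le hr.2⟩
    have hsR' : s ∈ Ioc 0 R := ⟨hs.1, hsR.2.le⟩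
    rw [hNd s hsR]
    refine mul_pos (sub_pos.2 ?_) (div_pos (hupos s hsR) (hθpos s hsR'))
    rcases le_or_gt lam 0 with hl | hl
    · nlinarith [sq_nonneg (θ s), pow_pos hν 2]
    · have hlt : θ s ^ 2 < θ r ^ 2 :=
        pow_lt_pow_left₀ (hθmono hsR' hr hs.2) (hθpos s hsR').le two_ne_zero
      exact (mul_lt_mul_of_pos_left hlt hl).trans_le hle
  have hNR : N R = 0 := by simp [hN, hneu]
  have hlam : ν ^ 2 < lam * θ R ^ 2 := by
    by_contra! h
    exact (hNpos R ⟨hR, le_rfl⟩ h).ne' hNR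
  refine ⟨fun r hr => ?_, hlam⟩
  have hr' : r ∈ Ioc 0 R := ⟨hr.1, hr.2.le⟩
  suffices 0 < N r from pos_of_mul_pos_right this (hθpos r hr').le
  rcases le_or_gt (lam * θ r ^ 2) (ν ^ 2) with h | h
  · exact hNpos r hr' h
  have hl : 0 < lam := pos_of_mul_pos_left ((pow_pos hν 2).trans h) (sq_nonneg _)
  have hanti : StrictAntiOn N (Icc r R) := by
    refine strictAntiOn_of_deriv_neg (convex_Icc r R)
      (hNc.mono fun s hs => ⟨hr.1.trans_le hs.1, hs.2⟩) fun s hs => ?_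
    rw [interior_Icc] at hs
    have hsR : s ∈ Ioo 0 R := ⟨hr.1.trans hs.1, hs.2⟩
    have hsR' : s ∈ Ioc 0 R := ⟨hsR.1, hs.2.le⟩
    rw [hNd s hsR]
    refine mul_neg_of_neg_of_pos (sub_neg.2 ?_) (div_pos (hupos s hsR) (hθpos s hsR'))
    have hlt : θ r ^ 2 < θ s ^ 2 :=
      pow_lt_pow_left₀ (hθmono hr' hsR' hs.1) (hθpos r hr').le two_ne_zero
    exact h.trans (mul_lt_mul_of_pos_left hlt hl)
  have := hanti ⟨le_rfl, hr.2.le⟩ ⟨hr.2.le, le_rfl⟩ hr.2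
  rwa [hNR] at this
end

section
/- Let ν ∈ (0, 1/2], λ > 0, R > 0. Let θ : (0,R] → ℝ be continuously differentiable with θ > 0 on (0,R], θ' > 0 on (0,R), and θ'(r) ≥ ν for all r ∈ (0,R). Let u : (0,R] → ℝ be twice continuously differentiable with u > 0 on (0,R), satisfying u''(r) + (θ'(r)/θ(r)) u'(r) + (λ − ν²/θ(r)²) u(r) = 0 on (0,R), u'(R) = 0, and such that θ(r)u'(r)/u(r) → ν as r → 0⁺. Then the function F(r) = u'(r)² + ν² u(r)²/θ(r)² is monotone nonincreasing on (0,R). -/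
open Set

/-- The derivative of the radial energy density is nonpositive wherever `u`, `u'` are nonnegative
and `θ' ≥ ν`; here `t, t', v, v', v''` are the values of `θ, θ', u, u', u''` at a point. -/
theorem radial_energy_deriv_nonpos {ν lam t t' v v' v'' : ℝ} (hν : 0 ≤ ν) (hlam : 0 ≤ lam)
    (ht : 0 < t) (ht' : ν ≤ t') (hv : 0 ≤ v) (hv' : 0 ≤ v')
    (heq : v'' + (t' / t) * v' + (lam - ν ^ 2 / t ^ 2) * v = 0) :
    2 * v' * v'' + 2 * ν ^ 2 * (v * v' / t ^ 2 - v ^ 2 * t' / t ^ 3) ≤ 0 := by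
  have hv'' : v'' = -((t' / t) * v') - (lam - ν ^ 2 / t ^ 2) * v := by linarith
  have key : 2 * v' * v'' + 2 * ν ^ 2 * (v * v' / t ^ 2 - v ^ 2 * t' / t ^ 3) =
      -(2 * ((t' - ν) / t * (v' ^ 2 + (ν * v / t) ^ 2) + ν / t * (v' - ν * v / t) ^ 2
        + lam * v * v')) := by
    rw [hv'']
    field_simp
    ring
  have hsub : 0 ≤ t' - ν := sub_nonneg.2 ht'
  rw [key, neg_nonpos]
  positivity

/-- A positive solution of the radial equation with Neumann condition at `R` and
`θ u' / u → ν > 0` at the origin is nondecreasing: `θ u'` first increases and then decreases,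
since its derivative has the sign of `ν² - λ θ²`. -/
theorem deriv_nonneg_of_radial_equation (ν lam R : ℝ) (hν : 0 < ν) (hlam : 0 < lam)
    (θ u : ℝ → ℝ)
    (hθd : ∀ r ∈ Ioc 0 R, DifferentiableAt ℝ θ r)
    (hθpos : ∀ r ∈ Ioc 0 R, 0 < θ r)
    (hθmono : StrictMonoOn θ (Ioo 0 R))
    (hud2 : ∀ r ∈ Ioc 0 R, DifferentiableAt ℝ (deriv u) r)
    (hupos : ∀ r ∈ Ioo 0 R, 0 < u r)
    (heq : ∀ r ∈ Ioo 0 R,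
      deriv (deriv u) r + (deriv θ r / θ r) * deriv u r + (lam - ν ^ 2 / θ r ^ 2) * u r = 0)
    (hneu : deriv u R = 0)
    (hq : Filter.Tendsto (fun r => θ r * deriv u r / u r) (nhdsWithin 0 (Ioi 0)) (nhds ν)) :
    ∀ r ∈ Ioo 0 R, 0 ≤ deriv u r := by
  have hwd : ∀ r ∈ Ioc 0 R, HasDerivAt (fun r => θ r * deriv u r)
      (deriv θ r * deriv u r + θ r * deriv (deriv u) r) r := fun r hr =>
    (hθd r hr).hasDerivAt.mul (hud2 r hr).hasDerivAt
  have hw' : ∀ r ∈ Ioo 0 R, deriv (fun r => θ r * deriv u r) r =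
      u r / θ r * (ν ^ 2 - lam * θ r ^ 2) := by
    intro r hr
    have hr' := Ioo_subset_Ioc_self hr
    have hθr := (hθpos r hr').ne'
    have h : deriv (deriv u) r =
        -((deriv θ r / θ r) * deriv u r) - (lam - ν ^ 2 / θ r ^ 2) * u r := by
      linarith [heq r hr]
    rw [(hwd r hr').deriv, h]
    field_simp
    ring
  intro r hr
  have hr' := Ioo_subset_Ioc_self hr
  refine nonneg_of_mul_nonneg_right ?_ (hθpos r hr')
  rcases le_or_gt (ν ^ 2) (lam * θ r ^ 2) with hle | hlt
  · have hsub : Icc r R ⊆ Ioc 0 R := fun x hx => ⟨hr.1.trans_le hx.1, hx.2⟩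
    have hanti : AntitoneOn (fun r => θ r * deriv u r) (Icc r R) := by
      refine antitoneOn_of_deriv_nonpos (convex_Icc r R)
        (fun x hx => (hwd x (hsub hx)).continuousAt.continuousWithinAt) ?_ ?_
      · exact fun x hx =>
          (hwd x (hsub (interior_subset hx))).differentiableAt.differentiableWithinAt
      · rw [interior_Icc]
        intro x hx
        have hx0 : x ∈ Ioo 0 R := ⟨hr.1.trans hx.1, hx.2⟩
        rw [hw' x hx0]
        have hθlt := hθmono hr hx0 hx.1
        have hθr := hθpos r hr'
        refine mul_nonpos_of_nonneg_of_nonpos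
          (div_nonneg (hupos x hx0).le (hθpos x (Ioo_subset_Ioc_self hx0)).le) ?_
        have : lam * θ r ^ 2 ≤ lam * θ x ^ 2 := by gcongr
        linarith
    have h := hanti (left_mem_Icc.2 hr.2.le) (right_mem_Icc.2 hr.2.le) hr.2.le
    simpa [hneu] using h
  · have hsub : Ioc 0 r ⊆ Ioo 0 R := fun x hx => ⟨hx.1, hx.2.trans_lt hr.2⟩
    have hmono : MonotoneOn (fun r => θ r * deriv u r) (Ioc 0 r) := by
      refine monotoneOn_of_deriv_nonneg (convex_Ioc 0 r)
        (fun x hx =>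
          (hwd x (Ioo_subset_Ioc_self (hsub hx))).continuousAt.continuousWithinAt) ?_ ?_
      · exact fun x hx => (hwd x (Ioo_subset_Ioc_self
          (hsub (interior_subset hx)))).differentiableAt.differentiableWithinAt
      · intro x hx
        have hxr := interior_subset hx
        have hx0 := hsub hxr
        rw [hw' x hx0]
        have hθle := hθmono.monotoneOn hx0 hr hxr.2
        have hθx := hθpos x (Ioo_subset_Ioc_self hx0)
        refine mul_nonneg (div_nonneg (hupos x hx0).le hθx.le) ?_
        have : lam * θ x ^ 2 ≤ lam * θ r ^ 2 := by gcongr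
        linarith
    obtain ⟨s, hqs, hs⟩ :=
      ((hq.eventually (lt_mem_nhds hν)).and (Ioc_mem_nhdsGT hr.1)).exists
    have hws : 0 < θ s * deriv u s := (div_pos_iff_of_pos_right (hupos s (hsub hs))).1 hqs
    exact hws.le.trans (hmono hs (right_mem_Ioc.2 hr.1) hs.2)

/-- Under the hypothesis θ' ≥ ν, the radial energy density F = u'² + ν²u²/θ² of a radial
first eigenfunction of the magnetic Neumann problem with Aharonov–Bohm flux ν is
monotone nonincreasing on (0,R). -/
theorem radial_energy_nonincreasing (ν lam R : ℝ)
    (hν : ν ∈ Ioc 0 (1 / 2 : ℝ)) (hlam : 0 < lam) (hR : 0 < R)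
    (θ u : ℝ → ℝ)
    (hθd : ∀ r ∈ Ioc 0 R, DifferentiableAt ℝ θ r)
    (hθ'c : ContinuousOn (deriv θ) (Ioc 0 R))
    (hθpos : ∀ r ∈ Ioc 0 R, 0 < θ r)
    (hθ'pos : ∀ r ∈ Ioo 0 R, 0 < deriv θ r)
    (hθ'ν : ∀ r ∈ Ioo 0 R, ν ≤ deriv θ r)
    (hud : ∀ r ∈ Ioc 0 R, DifferentiableAt ℝ u r)
    (hud2 : ∀ r ∈ Ioc 0 R, DifferentiableAt ℝ (deriv u) r)
    (hu''c : ContinuousOn (deriv (deriv u)) (Ioc 0 R))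
    (hupos : ∀ r ∈ Ioo 0 R, 0 < u r)
    (heq : ∀ r ∈ Ioo 0 R,
      deriv (deriv u) r + (deriv θ r / θ r) * deriv u r + (lam - ν ^ 2 / θ r ^ 2) * u r = 0)
    (hneu : deriv u R = 0)
    (hq : Filter.Tendsto (fun r => θ r * deriv u r / u r) (nhdsWithin 0 (Ioi 0)) (nhds ν)) :
    AntitoneOn (fun r => (deriv u r) ^ 2 + ν ^ 2 * (u r) ^ 2 / θ r ^ 2) (Ioo 0 R) := by
  have hθmono : StrictMonoOn θ (Ioo 0 R) := by
    refine strictMonoOn_of_deriv_pos (convex_Ioo 0 R)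
      (fun r hr => (hθd r (Ioo_subset_Ioc_self hr)).continuousAt.continuousWithinAt) ?_
    rw [interior_Ioo]
    exact hθ'pos
  have hu' := deriv_nonneg_of_radial_equation ν lam R hν.1 hlam θ u hθd hθpos hθmono hud2 hupos
    heq hneu hq
  have hF : ∀ r ∈ Ioo 0 R, HasDerivAt (fun r => (deriv u r) ^ 2 + ν ^ 2 * (u r) ^ 2 / θ r ^ 2)
      (2 * deriv u r * deriv (deriv u) r +
        2 * ν ^ 2 * (u r * deriv u r / θ r ^ 2 - u r ^ 2 * deriv θ r / θ r ^ 3)) r := by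
    intro r hr
    have hr' := Ioo_subset_Ioc_self hr
    have hθr := (hθpos r hr').ne'
    have h := ((hud2 r hr').hasDerivAt.pow 2).add
      ((((hud r hr').hasDerivAt.pow 2).const_mul (ν ^ 2)).div
        ((hθd r hr').hasDerivAt.pow 2) (pow_ne_zero 2 hθr))
    refine h.congr_deriv ?_
    simp only [Pi.pow_apply]
    field_simp
    ring
  refine antitoneOn_of_deriv_nonpos (convex_Ioo 0 R)
    (fun r hr => (hF r hr).continuousAt.continuousWithinAt) ?_ ?_
  · rw [interior_Ioo]
    exact fun r hr => (hF r hr).differentiableAt.differentiableWithinAt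
  · rw [interior_Ioo]
    intro r hr
    rw [(hF r hr).deriv]
    exact radial_energy_deriv_nonpos hν.1.le hlam.le (hθpos r (Ioo_subset_Ioc_self hr))
      (hθ'ν r hr) (hupos r hr).le (hu' r hr) (heq r hr)
end
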